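/- Let w_min be the hyperbolic generator of a geodesic tube 𝒯 of direction ω_i∨. Then w_min is conjugate in W^aff to a straight element of length ((ω_i∨, α_i∨)/(ω_i∨, ω_i∨))·⟨2ρ, ω_i∨⟩. -/

import Mathlib

open scoped RealInnerProductSpace

noncomputable section

/-- The ambient Euclidean space of rank `m`.  Via the fixed `W`-invariant inner product we
identify the space `V` containing the root system with its dual `V*`; the affine space `A`
underlying `V*` is then the Euclidean space itself. -/
abbrev E (m : ℕ) := EuclideanSpace ℝ (Fin m)

variable {m : ℕ}

/-- The coroot `α∨ = 2α/(α,α)` of a vector `α` (under the identification of `V` with `V*`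
given by the invariant inner product). -/
def coroot (α : E m) : E m := (2 / ⟪α, α⟫) • α

/-- The affine reflection `s_{α,k}(x) = x - (⟨α,x⟩ - k) α∨` as a function. -/
def affReflFun (α : E m) (k : ℤ) : E m → E m := fun x => x - (⟪α, x⟫ - (k : ℝ)) • coroot α

lemma affReflFun_involutive (α : E m) (k : ℤ) : Function.Involutive (affReflFun α k) := by
  intro x
  by_cases h : α = 0
  · simp [affReflFun, coroot, h]
  · have hαα : ⟪α, α⟫ ≠ (0:ℝ) := (inner_self_ne_zero (𝕜 := ℝ)).mpr h
    have h2 : ⟪α, coroot α⟫ = (2:ℝ) := by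
      unfold coroot
      rw [real_inner_smul_right, div_mul_cancel₀ _ hαα]
    have key : ∀ y : E m, ∀ s : ℝ, ⟪α, y - s • coroot α⟫ = ⟪α, y⟫ - 2 * s := by
      intro y s
      rw [inner_sub_right, real_inner_smul_right, h2]
      ring
    show affReflFun α k (x - (⟪α, x⟫ - (k:ℝ)) • coroot α) = x
    unfold affReflFun
    rw [key]
    rw [sub_sub, ← add_smul]
    rw [show (⟪α, x⟫ - (k:ℝ)) + (⟪α, x⟫ - 2 * (⟪α, x⟫ - (k:ℝ)) - (k:ℝ)) = 0 by ring]
    simp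

/-- The affine reflection `s_{α,k}` as a permutation of the affine space. -/
def affRefl (α : E m) (k : ℤ) : Equiv.Perm (E m) := (affReflFun_involutive α k).toPerm

/-- The affine Weyl group of a set of roots `Φ`: the group generated by all affine
reflections `s_{α,k}`, `α ∈ Φ`, `k ∈ ℤ`. -/
def Waff (Φ : Set (E m)) : Subgroup (Equiv.Perm (E m)) :=
  Subgroup.closure {w | ∃ α ∈ Φ, ∃ k : ℤ, w = affRefl α k}

/-- `Φ` is a reduced (crystallographic) root system spanning the ambient space. -/
structure IsRootSystem (Φ : Set (E m)) : Prop where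
  finite : Φ.Finite
  ne_zero : ∀ α ∈ Φ, α ≠ (0 : E m)
  span_eq_top : Submodule.span ℝ Φ = ⊤
  reflect_mem : ∀ α ∈ Φ, ∀ β ∈ Φ, β - ⟪α, β⟫ • coroot α ∈ Φ
  crystallographic : ∀ α ∈ Φ, ∀ β ∈ Φ, ∃ z : ℤ, ⟪α, coroot β⟫ = (z : ℝ)
  reduced : ∀ α ∈ Φ, ∀ t : ℝ, t • α ∈ Φ → t = 1 ∨ t = -1

/-- `B` is a system of simple roots of `Φ`. -/
structure IsSimpleSystem (Φ : Set (E m)) (B : Fin m → E m) : Prop where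
  mem : ∀ i, B i ∈ Φ
  indep : LinearIndependent ℝ B
  decomp : ∀ α ∈ Φ, (∃ c : Fin m → ℤ, α = ∑ j, (c j : ℝ) • B j ∧ ∀ j, 0 ≤ c j) ∨
                    (∃ c : Fin m → ℤ, α = ∑ j, (c j : ℝ) • B j ∧ ∀ j, c j ≤ 0)

/-- `ω` is the system of fundamental coweights relative to the simple roots `B`,
i.e. `⟨α_i, ω_j∨⟩ = δ_{ij}`. -/
def IsFundamentalCoweights (B ω : Fin m → E m) : Prop :=
  ∀ i j, ⟪B i, ω j⟫ = if i = j then (1 : ℝ) else 0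

/-- The wall `H_{α,k} = {x : ⟨α,x⟩ = k}`. -/
def wall (α : E m) (k : ℤ) : Set (E m) := {x | ⟪α, x⟫ = (k : ℝ)}

/-- The union of all walls of the root system `Φ`. -/
def allWalls (Φ : Set (E m)) : Set (E m) := ⋃ α ∈ Φ, ⋃ k : ℤ, wall α k

/-- An alcove: a connected component of the complement of the union of all walls. -/
def IsAlcove (Φ : Set (E m)) (C : Set (E m)) : Prop :=
  ∃ x ∈ (allWalls Φ)ᶜ, C = connectedComponentIn (allWalls Φ)ᶜ x

/-- The set `𝒲` of walls removed when forming geodesic tubes of direction `β∨`: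
all walls `H_{α,k}` with `⟨α, β∨⟩ = 0` (equivalently `α ∈ Φ_I`). -/
def tubeWalls (Φ : Set (E m)) (β : E m) : Set (E m) :=
  ⋃ α ∈ {α ∈ Φ | ⟪α, β⟫ = (0:ℝ)}, ⋃ k : ℤ, wall α k

/-- A geodesic tube of direction `β∨`: a connected component of `A ∖ ⋃𝒲`. -/
def IsGeodesicTube (Φ : Set (E m)) (β : E m) (T : Set (E m)) : Prop :=
  ∃ x ∈ (tubeWalls Φ β)ᶜ, T = connectedComponentIn (tubeWalls Φ β)ᶜ x

/-- `d_γ = inf_x d(x, γx)`. -/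
def minDisp (f : E m → E m) : ℝ := ⨅ x, dist x (f x)

/-- `Min(γ) = {x : d(x,γx) = d_γ}`. -/
def minSet (f : E m → E m) : Set (E m) := {x | dist x (f x) = minDisp f}

/-- A hyperbolic isometry: semisimple (`Min` nonempty) with `d_γ > 0`. -/
def IsHyperbolic (f : E m → E m) : Prop := (minSet f).Nonempty ∧ 0 < minDisp f

/-- `v` is the vector by which `γ` translates its min set. -/
def HasTransVec (f : E m → E m) (v : E m) : Prop := ∀ x ∈ minSet f, f x = x + v

/-- `x` is the barycenter of the polysimplex `s`: the average of the vertices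
(extreme points of the closure) of `s`. -/
def IsBarycenter (s : Set (E m)) (x : E m) : Prop :=
  ∃ F : Finset (E m), (F : Set (E m)) = Set.extremePoints ℝ (closure s) ∧ F.Nonempty ∧
    x = (F.card : ℝ)⁻¹ • ∑ y ∈ F, y

/-- The centerline `ℒ = x + ℝ β∨`. -/
def centerline (x β : E m) : Set (E m) := {p | ∃ t : ℝ, p = x + t • β}


/-- The finite Weyl group `W`, generated by the reflections `s_{α,0}`. -/
def W0 (Φ : Set (E m)) : Subgroup (Equiv.Perm (E m)) :=
  Subgroup.closure {w | ∃ α ∈ Φ, w = affRefl α 0}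

/-- `α̃` is the highest root of `Φ` relative to the simple system `B`. -/
def IsHighestRoot (Φ : Set (E m)) (B : Fin m → E m) (αh : E m) : Prop :=
  αh ∈ Φ ∧ ∀ α ∈ Φ, ∃ c : Fin m → ℝ, (∀ j, 0 ≤ c j) ∧ αh - α = ∑ j, c j • B j

/-- The standard Coxeter generating set `{s_0} ∪ S` of the affine Weyl group, where
`s_0 = s_{-α̃,1}` and `s_i = s_{α_i,0}`. -/
def SAff (B : Fin m → E m) (αh : E m) : Set (Equiv.Perm (E m)) :=
  {w | (∃ i, w = affRefl (B i) 0) ∨ w = affRefl (-αh) 1}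

/-- Word length with respect to a generating set `S` of a group. -/
def len {G : Type*} [Group G] (S : Set G) (w : G) : ℕ :=
  sInf {k | ∃ l : List G, (∀ g ∈ l, g ∈ S) ∧ l.length = k ∧ l.prod = w}

/-- A straight element: `ℓ(w^k) = k ℓ(w)` for all `k ∈ ℕ`. -/
def IsStraight {G : Type*} [Group G] (S : Set G) (w : G) : Prop :=
  ∀ k : ℕ, len S (w ^ k) = k * len S w

/-- `P` is the set of positive roots of `Φ` relative to `B`. -/
def IsPositiveSystem (Φ : Set (E m)) (B : Fin m → E m) (P : Finset (E m)) : Prop :=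
  (P : Set (E m)) = {α ∈ Φ | ∃ c : Fin m → ℝ, (∀ j, 0 ≤ c j) ∧ α = ∑ j, c j • B j}

/-- `w` is a hyperbolic element of the affine Weyl group stabilizing the tube `T`. -/
def IsHypStab (Φ : Set (E m)) (T : Set (E m)) (w : Equiv.Perm (E m)) : Prop :=
  w ∈ Waff Φ ∧ IsHyperbolic (w : E m → E m) ∧ (w : E m → E m) '' T = T

/-- The affine function `x ↦ ⟨α,x⟩ - k`. -/
def aff (α : E m) (k : ℤ) (x : E m) : ℝ := ⟪α, x⟫ - (k : ℝ)

lemma affRefl_apply (α : E m) (k : ℤ) (x : E m) :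
    affRefl α k x = x - aff α k x • coroot α := rfl

lemma affRefl_affRefl (α : E m) (k : ℤ) (x : E m) : affRefl α k (affRefl α k x) = x :=
  affReflFun_involutive α k x

lemma affRefl_mul_self (α : E m) (k : ℤ) : affRefl α k * affRefl α k = 1 := by
  ext1 x
  exact affRefl_affRefl α k x

lemma affRefl_inv (α : E m) (k : ℤ) : (affRefl α k)⁻¹ = affRefl α k :=
  inv_eq_of_mul_eq_one_left (affRefl_mul_self α k)

lemma inner_coroot_self {α : E m} (h : α ≠ 0) : ⟪α, coroot α⟫ = (2 : ℝ) := by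
  have hαα : ⟪α, α⟫ ≠ (0:ℝ) := (inner_self_ne_zero (𝕜 := ℝ)).mpr h
  unfold coroot
  rw [real_inner_smul_right, div_mul_cancel₀ _ hαα]

lemma coroot_neg (α : E m) : coroot (-α) = - coroot α := by
  simp [coroot]

lemma affRefl_neg (α : E m) (k : ℤ) : affRefl (-α) (-k) = affRefl α k := by
  ext1 x
  rw [affRefl_apply, affRefl_apply, coroot_neg]
  simp only [aff, inner_neg_left]
  push_cast
  module

lemma affRefl_mem {Φ : Set (E m)} {α : E m} (h : α ∈ Φ) (k : ℤ) : affRefl α k ∈ Waff Φ :=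
  Subgroup.subset_closure ⟨α, h, k, rfl⟩

/-- value of an affine function on a reflected point -/
lemma aff_affRefl (β : E m) (l : ℤ) (α : E m) (k : ℤ) (x : E m) :
    aff β l (affRefl α k x) = aff β l x - aff α k x * ⟪β, coroot α⟫ := by
  rw [affRefl_apply]
  simp only [aff, inner_sub_right, real_inner_smul_right]
  ring

lemma inner_coroot_mul (α β : E m) : ⟪β, coroot α⟫ • α = ⟪α, β⟫ • coroot α := by
  unfold coroot
  rw [real_inner_smul_right, smul_smul, real_inner_comm β α, mul_comm]

/-- pulling back an affine root along a reflection -/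
lemma aff_comp_refl {β α : E m} {l k z : ℤ} (hz : ⟪β, coroot α⟫ = (z : ℝ)) (x : E m) :
    aff β l (affRefl α k x) = aff (β - ⟪α, β⟫ • coroot α) (l - k * z) x := by
  rw [aff_affRefl, hz, ← inner_coroot_mul, hz]
  simp only [aff, inner_sub_left, real_inner_smul_left]
  push_cast
  ring

/-- linear reflection -/
lemma exists_linRefl (α : E m) : ∃ u : E m ≃ₗᵢ[ℝ] E m, (∀ x, u x = x - ⟪α, x⟫ • coroot α) ∧
    ∀ x, u.symm x = u x := by
  refine ⟨Submodule.reflection (Submodule.span ℝ {α})ᗮ, ?_, ?_⟩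
  · intro x
    rw [Submodule.reflection_orthogonal_apply, Submodule.reflection_singleton_apply]
    rw [neg_sub]
    congr 1
    unfold coroot
    rw [real_inner_self_eq_norm_sq, smul_smul, two_smul, ← add_smul]
    congr 1
    simp only [RCLike.ofReal_real_eq_id, id]
    ring
  · intro x
    rw [Submodule.reflection_symm]

/-- The coroot lattice. -/
def corootLattice (Φ : Set (E m)) : AddSubgroup (E m) := AddSubgroup.closure (coroot '' Φ)

/-- `w` is the affine map with linear part `u` and translation part `v`. -/
structure IsRep (Φ : Set (E m)) (w : Equiv.Perm (E m)) (u : E m ≃ₗᵢ[ℝ] E m) (v : E m) : Prop where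
  eq : ∀ x, w x = u x + v
  mem : ∀ α ∈ Φ, u α ∈ Φ
  symm_mem : ∀ α ∈ Φ, u.symm α ∈ Φ
  lat : v ∈ corootLattice Φ

lemma coroot_map (u : E m ≃ₗᵢ[ℝ] E m) (α : E m) : coroot (u α) = u (coroot α) := by
  simp [coroot]

lemma corootLattice_map {Φ : Set (E m)} (u : E m ≃ₗᵢ[ℝ] E m) (h : ∀ α ∈ Φ, u α ∈ Φ) {v : E m}
    (hv : v ∈ corootLattice Φ) : u v ∈ corootLattice Φ := by
  induction hv using AddSubgroup.closure_induction with
  | mem x hx =>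
    obtain ⟨α, hα, rfl⟩ := hx
    rw [← coroot_map]
    exact AddSubgroup.subset_closure ⟨_, h α hα, rfl⟩
  | zero => simp
  | add x y _ _ hx hy => rw [map_add]; exact AddSubgroup.add_mem _ hx hy
  | neg x _ hx => rw [map_neg]; exact AddSubgroup.neg_mem _ hx

lemma IsRep.inv {Φ : Set (E m)} {w : Equiv.Perm (E m)} {u : E m ≃ₗᵢ[ℝ] E m} {v : E m}
    (h : IsRep Φ w u v) : IsRep Φ w⁻¹ u.symm (-(u.symm v)) where
  eq := by
    intro x
    rw [Equiv.Perm.inv_eq_iff_eq, h.eq]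
    simp
  mem := h.symm_mem
  symm_mem := h.mem
  lat := AddSubgroup.neg_mem _ (corootLattice_map _ h.symm_mem h.lat)

lemma IsRep.one {Φ : Set (E m)} : IsRep Φ 1 (LinearIsometryEquiv.refl ℝ _) 0 where
  eq := fun x => (add_zero x).symm
  mem := fun _ h => h
  symm_mem := fun _ h => h
  lat := AddSubgroup.zero_mem _

lemma IsRep.mul {Φ : Set (E m)} {w w' : Equiv.Perm (E m)} {u u' : E m ≃ₗᵢ[ℝ] E m} {v v' : E m}
    (h : IsRep Φ w u v) (h' : IsRep Φ w' u' v') :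
    IsRep Φ (w * w') (u'.trans u) (u v' + v) where
  eq := by
    intro x
    rw [Equiv.Perm.mul_apply, h'.eq, h.eq, map_add, add_assoc]
    rfl
  mem := fun α hα => h.mem _ (h'.mem _ hα)
  symm_mem := fun α hα => h'.symm_mem _ (h.symm_mem _ hα)
  lat := AddSubgroup.add_mem _ (corootLattice_map _ h.mem h'.lat) h.lat

lemma exists_rep {Φ : Set (E m)} (hΦ : IsRootSystem Φ) {w : Equiv.Perm (E m)} (hw : w ∈ Waff Φ) :
    ∃ u v, IsRep Φ w u v := by
  induction hw using Subgroup.closure_induction with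
  | mem w hw =>
    obtain ⟨α, hα, k, rfl⟩ := hw
    obtain ⟨u, hu, hu'⟩ := exists_linRefl α
    refine ⟨u, k • coroot α, ?_, ?_, ?_, ?_⟩
    · intro x
      rw [affRefl_apply, hu, aff, sub_smul, ← Int.cast_smul_eq_zsmul ℝ]
      abel
    · intro β hβ
      rw [hu]
      exact hΦ.reflect_mem α hα β hβ
    · intro β hβ
      rw [hu', hu]
      exact hΦ.reflect_mem α hα β hβ
    · exact AddSubgroup.zsmul_mem _ (AddSubgroup.subset_closure (Set.mem_image_of_mem _ hα)) k
  | one => exact ⟨_, _, IsRep.one⟩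
  | mul x y _ _ hx hy =>
    obtain ⟨u, v, h⟩ := hx
    obtain ⟨u', v', h'⟩ := hy
    exact ⟨_, _, h.mul h'⟩
  | inv x _ hx =>
    obtain ⟨u, v, h⟩ := hx
    exact ⟨_, _, h.inv⟩

lemma lattice_int {Φ : Set (E m)} (hΦ : IsRootSystem Φ) {α v : E m} (hα : α ∈ Φ)
    (hv : v ∈ corootLattice Φ) : ∃ z : ℤ, ⟪α, v⟫ = (z : ℝ) := by
  induction hv using AddSubgroup.closure_induction with
  | mem x hx =>
    obtain ⟨β, hβ, rfl⟩ := hx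
    exact hΦ.crystallographic α hα β hβ
  | zero => exact ⟨0, by simp⟩
  | add x y _ _ hx hy =>
    obtain ⟨a, ha⟩ := hx
    obtain ⟨b, hb⟩ := hy
    exact ⟨a + b, by rw [inner_add_right, ha, hb]; push_cast; rfl⟩
  | neg x _ hx =>
    obtain ⟨a, ha⟩ := hx
    exact ⟨-a, by rw [inner_neg_right, ha]; push_cast; rfl⟩

/-- affine roots pull back along group elements -/
lemma IsRep.pull {Φ : Set (E m)} (hΦ : IsRootSystem Φ) {w : Equiv.Perm (E m)}
    {u : E m ≃ₗᵢ[ℝ] E m} {v : E m} (h : IsRep Φ w u v) {α : E m} (hα : α ∈ Φ) (k : ℤ) :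
    ∃ k' : ℤ, ∀ y, aff α k (w y) = aff (u.symm α) k' y := by
  obtain ⟨z, hz⟩ := lattice_int hΦ hα h.lat
  refine ⟨k - z, fun y => ?_⟩
  have : ⟪u.symm α, y⟫ = ⟪α, u y⟫ := by
    rw [← u.inner_map_map, u.apply_symm_apply]
  simp only [aff, this, h.eq, inner_add_right, hz]
  push_cast
  ring

lemma neg_mem_root {Φ : Set (E m)} (hΦ : IsRootSystem Φ) {α : E m} (hα : α ∈ Φ) : -α ∈ Φ := by
  have h := hΦ.reflect_mem α hα α hα
  rw [← inner_coroot_mul, inner_coroot_self (hΦ.ne_zero α hα)] at h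
  convert h using 1
  module

/-- Affine roots. -/
def AR (Ψ : Set (E m)) : Set (E m → ℝ) := {b | ∃ α ∈ Ψ, ∃ k : ℤ, b = aff α k}

/-- Affine roots positive at `x` and negative at `y`. -/
def Nset (Ψ : Set (E m)) (x y : E m) : Set (E m → ℝ) := {b | b ∈ AR Ψ ∧ 0 < b x ∧ b y < 0}

/-- The number of walls separating `x` and `y`. -/
def sepNum (Ψ : Set (E m)) (x y : E m) : ℕ := (Nset Ψ x y).ncard

lemma Nset_finite {Ψ : Set (E m)} (hf : Ψ.Finite) (x y : E m) : (Nset Ψ x y).Finite := by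
  have : (⋃ α ∈ Ψ, (aff α) '' (Set.Icc ⌊⟪α, y⟫⌋ ⌈⟪α, x⟫⌉)).Finite :=
    hf.biUnion fun α _ => (Set.finite_Icc _ _).image _
  refine this.subset ?_
  rintro b ⟨⟨α, hα, k, rfl⟩, h1, h2⟩
  simp only [aff] at h1 h2
  refine Set.mem_biUnion hα ⟨k, ⟨?_, ?_⟩, rfl⟩
  · have : (⌊⟪α, y⟫⌋ : ℝ) ≤ k := (Int.floor_le _).trans (by linarith)
    exact_mod_cast this
  · have : (k : ℝ) ≤ ⌈⟪α, x⟫⌉ := le_trans (by linarith) (Int.le_ceil _)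
    exact_mod_cast this

lemma AR_comp {Φ : Set (E m)} (hΦ : IsRootSystem Φ) {w : Equiv.Perm (E m)} (hw : w ∈ Waff Φ)
    {b : E m → ℝ} (hb : b ∈ AR Φ) : b ∘ w ∈ AR Φ := by
  obtain ⟨α, hα, k, rfl⟩ := hb
  obtain ⟨u, v, h⟩ := exists_rep hΦ hw
  obtain ⟨k', hk⟩ := h.pull hΦ hα k
  exact ⟨_, h.symm_mem α hα, k', funext hk⟩

lemma AR_neg {Φ : Set (E m)} (hΦ : IsRootSystem Φ) {b : E m → ℝ} (hb : b ∈ AR Φ) : -b ∈ AR Φ := by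
  obtain ⟨α, hα, k, rfl⟩ := hb
  refine ⟨-α, neg_mem_root hΦ hα, -k, ?_⟩
  funext x
  simp [aff]
  ring

/-- Regular points. -/
def Regular (Ψ : Set (E m)) (x : E m) : Prop := ∀ b ∈ AR Ψ, b x ≠ 0

lemma Regular.map {Φ : Set (E m)} (hΦ : IsRootSystem Φ) {w : Equiv.Perm (E m)} (hw : w ∈ Waff Φ)
    {x : E m} (hx : Regular Φ x) : Regular Φ (w x) :=
  fun _ hb => hx _ (AR_comp hΦ hw hb)

lemma sepNum_map_le {Φ : Set (E m)} (hΦ : IsRootSystem Φ) {w : Equiv.Perm (E m)} (hw : w ∈ Waff Φ)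
    (x y : E m) : sepNum Φ (w x) (w y) ≤ sepNum Φ x y := by
  refine Set.ncard_le_ncard_of_injOn (fun b => b ∘ w) ?_ ?_ (Nset_finite hΦ.finite x y)
  · rintro b ⟨hb, h1, h2⟩
    exact ⟨AR_comp hΦ hw hb, h1, h2⟩
  · intro b _ b' _ h
    exact (Equiv.surjective w).injective_comp_right h

lemma sepNum_map {Φ : Set (E m)} (hΦ : IsRootSystem Φ) {w : Equiv.Perm (E m)} (hw : w ∈ Waff Φ)
    (x y : E m) : sepNum Φ (w x) (w y) = sepNum Φ x y := by
  apply le_antisymm (sepNum_map_le hΦ hw x y)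
  have := sepNum_map_le hΦ (inv_mem hw) (w x) (w y)
  simpa using this

lemma sepNum_triangle {Ψ : Set (E m)} (hf : Ψ.Finite) {x y z : E m} (hy : Regular Ψ y) :
    sepNum Ψ x z ≤ sepNum Ψ x y + sepNum Ψ y z := by
  refine le_trans (Set.ncard_le_ncard ?_ ((Nset_finite hf x y).union (Nset_finite hf y z)))
    (Set.ncard_union_le _ _)
  rintro b ⟨hb, h1, h2⟩
  rcases lt_or_gt_of_ne (hy b hb) with h | h
  · exact Or.inl ⟨hb, h1, h⟩
  · exact Or.inr ⟨hb, h, h2⟩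

/-- Reflecting in a separating wall decreases the distance. -/
lemma sepNum_refl_lt {Ψ : Set (E m)} (hf : Ψ.Finite)
    (hr : ∀ α ∈ Ψ, ∀ β ∈ Ψ, β - ⟪α, β⟫ • coroot α ∈ Ψ)
    (hc : ∀ α ∈ Ψ, ∀ β ∈ Ψ, ∃ z : ℤ, ⟪α, coroot β⟫ = (z : ℝ))
    {x y : E m} (hy : Regular Ψ y) {α : E m} (hα : α ∈ Ψ) {k : ℤ}
    (hsep : aff α k x * aff α k y < 0) (h0 : α ≠ 0) :
    sepNum Ψ x (affRefl α k y) < sepNum Ψ x y := by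
  classical
  have hcomp : ∀ b ∈ AR Ψ, b ∘ (affRefl α k) ∈ AR Ψ := by
    rintro _ ⟨β, hβ, l, rfl⟩
    obtain ⟨z, hz⟩ := hc β hβ α hα
    exact ⟨_, hr α hα β hβ, l - k * z, funext fun x => aff_comp_refl hz x⟩
  have hmono : ∀ b ∈ AR Ψ, 0 < b y → b (affRefl α k y) < 0 → b x < b (affRefl α k x) := by
    rintro _ ⟨β, hβ, l, rfl⟩ h1 h2
    rw [aff_affRefl] at h2 ⊢
    have h3 : 0 < aff α k y * ⟪β, coroot α⟫ := by linarith
    have h4 : (aff α k x * aff α k y) * (aff α k y * ⟪β, coroot α⟫) < 0 :=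
      mul_neg_of_neg_of_pos hsep h3
    have h5 : 0 ≤ aff α k y ^ 2 := sq_nonneg _
    have h6 : aff α k x * ⟪β, coroot α⟫ < 0 := by
      by_contra hcon
      push Not at hcon
      have := mul_nonneg h5 hcon
      nlinarith
    linarith
  have hself : ∀ p, aff α k (affRefl α k p) = - aff α k p := by
    intro p
    rw [aff_affRefl, inner_coroot_self h0]
    ring
  have hneg : -α ∈ Ψ := by
    have h := hr α hα α hα
    rw [← inner_coroot_mul, inner_coroot_self h0] at h
    convert h using 1
    module
  obtain ⟨a, haR, hax, hay, has⟩ : ∃ a ∈ AR Ψ, 0 < a x ∧ a y < 0 ∧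
      ∀ p, a (affRefl α k p) = - a p := by
    rcases mul_neg_iff.mp hsep with ⟨h1, h2⟩ | ⟨h1, h2⟩
    · exact ⟨_, ⟨α, hα, k, rfl⟩, h1, h2, hself⟩
    · have e : ∀ p, aff (-α) (-k) p = - aff α k p := by
        intro p; simp [aff]; ring
      refine ⟨_, ⟨-α, hneg, -k, rfl⟩, ?_, ?_, ?_⟩
      · rw [e]; linarith
      · rw [e]; linarith
      · intro p; rw [e, e, hself]
  have hmem : a ∈ Nset Ψ x y := ⟨haR, hax, hay⟩
  refine lt_of_le_of_lt ?_
    (Set.ncard_sdiff_singleton_lt_of_mem hmem (Nset_finite hf x y))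
  refine Set.ncard_le_ncard_of_injOn (fun b => if b y < 0 then b else b ∘ affRefl α k) ?_ ?_
    ((Nset_finite hf x y).subset Set.sdiff_subset)
  · rintro b ⟨hb, h1, h2⟩
    by_cases hby : b y < 0
    · simp only [hby, if_true]
      refine ⟨⟨hb, h1, hby⟩, ?_⟩
      rintro rfl
      rw [has] at h2
      linarith
    · simp only [hby, if_false]
      have hby' : 0 < b y := lt_of_le_of_ne (not_lt.mp hby) (hy b hb).symm
      refine ⟨⟨hcomp b hb, h1.trans (hmono b hb hby' h2), h2⟩, ?_⟩
      intro h
      have h' : b (affRefl α k (affRefl α k x)) = a (affRefl α k x) := congrFun h (affRefl α k x)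
      rw [affRefl_affRefl, has] at h'
      linarith
  · have key : ∀ b b' : E m → ℝ, b (affRefl α k y) < 0 → ¬ b' y < 0 →
        b = b' ∘ affRefl α k → False := by
      intro b b' h1 h2 h
      rw [h] at h1
      simp only [Function.comp, affRefl_affRefl] at h1
      exact h2 h1
    rintro b ⟨hb, h1, h2⟩ b' ⟨hb', h1', h2'⟩ h
    by_cases c : b y < 0 <;> by_cases c' : b' y < 0
    · simpa only [c, c', if_true] using h
    · simp only [c, c', if_true, if_false] at h
      exact (key b b' h2 c' h).elim
    · simp only [c, c', if_true, if_false] at h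
      exact (key b' b h2' c h.symm).elim
    · simp only [c, c', if_false] at h
      exact (Equiv.surjective _).injective_comp_right h

lemma Waff_regular {Ψ : Set (E m)}
    (hr : ∀ α ∈ Ψ, ∀ β ∈ Ψ, β - ⟪α, β⟫ • coroot α ∈ Ψ)
    (hc : ∀ α ∈ Ψ, ∀ β ∈ Ψ, ∃ z : ℤ, ⟪α, coroot β⟫ = (z : ℝ))
    {α : E m} (hα : α ∈ Ψ) (k : ℤ) {y : E m} (hy : Regular Ψ y) : Regular Ψ (affRefl α k y) := by
  rintro _ ⟨β, hβ, l, rfl⟩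
  obtain ⟨z, hz⟩ := hc β hβ α hα
  rw [aff_comp_refl hz]
  exact hy _ ⟨_, hr α hα β hβ, _, rfl⟩

/-- Transitivity: any regular point can be moved to a point not separated from `x`. -/
lemma exists_move {Ψ : Set (E m)} (hf : Ψ.Finite) (h0 : ∀ α ∈ Ψ, α ≠ 0)
    (hr : ∀ α ∈ Ψ, ∀ β ∈ Ψ, β - ⟪α, β⟫ • coroot α ∈ Ψ)
    (hc : ∀ α ∈ Ψ, ∀ β ∈ Ψ, ∃ z : ℤ, ⟪α, coroot β⟫ = (z : ℝ))
    {x : E m} (hx : Regular Ψ x) : ∀ (n : ℕ) (y : E m), Regular Ψ y → sepNum Ψ x y = n →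
    ∃ g ∈ Waff Ψ, ∀ α ∈ Ψ, ∀ k : ℤ, 0 < aff α k x * aff α k (g y) := by
  intro n
  induction n using Nat.strong_induction_on with
  | _ n ih =>
    intro y hy hn
    by_cases h : ∀ α ∈ Ψ, ∀ k : ℤ, 0 < aff α k x * aff α k y
    · exact ⟨1, one_mem _, h⟩
    · push Not at h
      obtain ⟨α, hα, k, hk⟩ := h
      have hk' : aff α k x * aff α k y < 0 :=
        lt_of_le_of_ne hk (mul_ne_zero (hx _ ⟨α, hα, k, rfl⟩) (hy _ ⟨α, hα, k, rfl⟩))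
      have hlt := sepNum_refl_lt hf hr hc hy hα hk' (h0 α hα)
      obtain ⟨g, hg, hg'⟩ := ih _ (hn ▸ hlt) _ (Waff_regular hr hc hα k hy) rfl
      exact ⟨g * affRefl α k, mul_mem hg (affRefl_mem hα k), hg'⟩
/-- `s` is the reflection in the wall `aff γ l = 0`, which is the only wall separating a point of
the alcove `C` from its mirror image. -/
structure SimpleAff (Φ C : Set (E m)) (s : Equiv.Perm (E m)) (γ : E m) (l : ℤ) : Prop where
  mem : γ ∈ Φ
  eq : s = affRefl γ l
  pos : ∀ x ∈ C, 0 < aff γ l x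
  only : ∀ x ∈ C, ∀ b ∈ Nset Φ x (s x), b = aff γ l

/-- The data needed for the Coxeter combinatorics. -/
structure Cox (Φ C : Set (E m)) (S : Set (Equiv.Perm (E m))) : Prop where
  simple : ∀ s ∈ S, ∃ γ l, SimpleAff Φ C s γ l
  sep : ∀ y, Regular Φ y → y ∉ C → ∃ s ∈ S, ∃ γ l, SimpleAff Φ C s γ l ∧ aff γ l y < 0
  reg : ∀ x ∈ C, Regular Φ x
  same : ∀ x ∈ C, ∀ y ∈ C, Nset Φ x y = ∅

section cox
variable {Φ C : Set (E m)} {S : Set (Equiv.Perm (E m))}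

lemma SimpleAff.inWaff {s : Equiv.Perm (E m)} {γ : E m} {l : ℤ} (h : SimpleAff Φ C s γ l) :
    s ∈ Waff Φ := by
  rw [h.eq]; exact affRefl_mem h.mem l

lemma SimpleAff.mul_self {s : Equiv.Perm (E m)} {γ : E m} {l : ℤ} (h : SimpleAff Φ C s γ l) :
    s * s = 1 := by
  rw [h.eq]; exact affRefl_mul_self γ l

lemma Cox.list_mem (hC : Cox Φ C S) {L : List (Equiv.Perm (E m))} (hL : ∀ g ∈ L, g ∈ S) :
    L.prod ∈ Waff Φ := by
  refine Subgroup.list_prod_mem _ fun g hg => ?_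
  obtain ⟨γ, l, h⟩ := hC.simple g (hL g hg)
  exact h.inWaff

lemma affRefl_congr_neg {α γ : E m} {k l : ℤ} (h0 : γ ≠ 0)
    (h : ∀ y, aff γ l (affRefl α k y) = - aff γ l y) : affRefl α k = affRefl γ l := by
  set n : ℝ := ⟪γ, coroot α⟫ with hn
  have h1 : ∀ y, 2 * aff γ l y = aff α k y * n := by
    intro y
    have := h y
    rw [aff_affRefl] at this
    linarith
  have h2 : (2:ℝ) • γ = n • α := by
    apply ext_inner_right ℝ
    intro y
    have e1 := h1 y
    have e2 := h1 0
    simp only [aff, inner_zero_right] at e1 e2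
    rw [real_inner_smul_left, real_inner_smul_left]
    linarith
  have hn0 : n ≠ 0 := by
    intro h3
    rw [h3, zero_smul] at h2
    exact h0 (by simpa using h2)
  have hα : α = (2 / n) • γ := by
    rw [div_eq_inv_mul, mul_smul, h2, smul_smul, inv_mul_cancel₀ hn0, one_smul]
  have hγγ : ⟪γ, γ⟫ ≠ (0:ℝ) := (inner_self_ne_zero (𝕜 := ℝ)).mpr h0
  ext1 y
  rw [affRefl_apply, affRefl_apply]
  congr 1
  have e : aff γ l y = aff α k y * n / 2 := by rw [← h1]; ring
  rw [e]
  unfold coroot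
  rw [smul_smul, smul_smul]
  rw [hα]
  rw [real_inner_smul_left, real_inner_smul_right, smul_smul]
  congr 1
  field_simp

lemma affRefl_congr {α γ : E m} {k l : ℤ} (h : aff γ l = aff α k) (h0 : γ ≠ 0) :
    affRefl α k = affRefl γ l := by
  have h1 : ∀ y, aff γ l y = aff α k y := fun y => congrFun h y
  have hα : α ≠ 0 := by
    rintro rfl
    have e1 := h1 γ
    have e2 := h1 0
    simp only [aff, inner_zero_right, inner_zero_left] at e1 e2
    exact (inner_self_ne_zero (𝕜 := ℝ)).mpr h0 (by linarith)
  apply affRefl_congr_neg h0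
  intro y
  rw [h1, h1, aff_affRefl, inner_coroot_self hα]
  ring

/-- If the wall of `(α,k)` separates `x ∈ C` and `s x`, then it is the wall of `s`. -/
lemma SimpleAff.eq_of_sep (hΦ : IsRootSystem Φ) {s : Equiv.Perm (E m)} {γ : E m} {l : ℤ}
    (h : SimpleAff Φ C s γ l) {x : E m} (hx : x ∈ C) {α : E m} (hα : α ∈ Φ) {k : ℤ}
    (hs : aff α k x * aff α k (s x) < 0) : affRefl α k = s := by
  rw [h.eq]
  rcases mul_neg_iff.mp hs with ⟨h1, h2⟩ | ⟨h1, h2⟩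
  · exact affRefl_congr (h.only x hx _ ⟨⟨α, hα, k, rfl⟩, h1, h2⟩).symm (hΦ.ne_zero _ h.mem)
  · have e : ∀ p, aff (-α) (-k) p = - aff α k p := by
      intro p; simp [aff]; ring
    rw [← affRefl_neg]
    refine affRefl_congr (h.only x hx _ ⟨⟨-α, neg_mem_root hΦ hα, -k, rfl⟩, ?_, ?_⟩).symm
      (hΦ.ne_zero _ h.mem)
    · rw [e]; linarith
    · rw [e]; linarith

/-- conjugation of reflections -/
lemma affRefl_conj (hΦ : IsRootSystem Φ) {w : Equiv.Perm (E m)} (hw : w ∈ Waff Φ) {α : E m}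
    (hα : α ∈ Φ) (k : ℤ) : ∃ α' ∈ Φ, ∃ k' : ℤ, (∀ y, aff α' k' y = aff α k (w y)) ∧
      affRefl α' k' = w⁻¹ * affRefl α k * w := by
  obtain ⟨u, v, h⟩ := exists_rep hΦ hw
  obtain ⟨k', hk⟩ := h.pull hΦ hα k
  refine ⟨_, h.symm_mem α hα, k', fun y => (hk y).symm, ?_⟩
  rw [mul_assoc, eq_inv_mul_iff_mul_eq]
  ext1 y
  simp only [Equiv.Perm.mul_apply]
  rw [affRefl_apply α, hk, h.eq, affRefl_apply, h.eq, map_sub, map_smul, ← coroot_map,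
    u.apply_symm_apply]
  abel

/-- The strong exchange property. -/
lemma Cox.exchange (hΦ : IsRootSystem Φ) (hC : Cox Φ C S) {x : E m} (hx : x ∈ C) :
    ∀ (L : List (Equiv.Perm (E m))), (∀ g ∈ L, g ∈ S) → ∀ α ∈ Φ, ∀ k : ℤ,
      aff α k x * aff α k (L.prod x) < 0 →
      ∃ L' : List (Equiv.Perm (E m)), (∀ g ∈ L', g ∈ S) ∧ L'.length < L.length ∧
        affRefl α k * L.prod = L'.prod := by
  intro L
  induction L with
  | nil =>
    intro _ α _ k h
    simp only [List.prod_nil, Equiv.Perm.one_apply] at h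
    nlinarith [sq_nonneg (aff α k x)]
  | cons s L ih =>
    intro hL α hα k h
    obtain ⟨γ, l, hs⟩ := hC.simple s (hL s (by simp))
    have hL' : ∀ g ∈ L, g ∈ S := fun g hg => hL g (by simp [hg])
    have hreg : aff α k (s x) ≠ 0 := (hC.reg x hx).map hΦ hs.inWaff _ ⟨α, hα, k, rfl⟩
    have hreg0 : aff α k x ≠ 0 := (hC.reg x hx) _ ⟨α, hα, k, rfl⟩
    rw [List.prod_cons] at h ⊢
    rcases lt_or_gt_of_ne (mul_ne_zero hreg0 hreg) with h1 | h1
    · refine ⟨L, hL', by simp, ?_⟩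
      rw [hs.eq_of_sep hΦ hx hα h1, ← mul_assoc, hs.mul_self, one_mul]
    · obtain ⟨α', hα', k', hk', hconj⟩ := affRefl_conj hΦ hs.inWaff hα k
      obtain ⟨L', hL'S, hlen, heq⟩ := ih hL' α' hα' k' (by
        rw [hk', hk']
        rw [Equiv.Perm.mul_apply] at h
        have h3 : (aff α k x * aff α k (s x)) * (aff α k x * aff α k (s (L.prod x))) < 0 :=
          mul_neg_of_pos_of_neg h1 h
        by_contra hcon
        push Not at hcon
        have := mul_nonneg (sq_nonneg (aff α k x)) hcon
        nlinarith)
      refine ⟨s :: L', ?_, by simpa using hlen, ?_⟩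
      · intro g hg
        rcases List.mem_cons.mp hg with rfl | hg
        · exact hL _ (by simp)
        · exact hL'S g hg
      · rw [List.prod_cons, ← heq, hconj]
        group

lemma Cox.sepNum_simple {s : Equiv.Perm (E m)} {γ : E m} {l : ℤ}
    (h : SimpleAff Φ C s γ l) {x : E m} (hx : x ∈ C) : sepNum Φ x (s x) ≤ 1 := by
  have : Nset Φ x (s x) ⊆ {aff γ l} := fun b hb => h.only x hx b hb
  exact (Set.ncard_le_ncard this).trans (by simp)

lemma Cox.sepNum_le (hΦ : IsRootSystem Φ) (hC : Cox Φ C S) {x : E m} (hx : x ∈ C) :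
    ∀ (L : List (Equiv.Perm (E m))), (∀ g ∈ L, g ∈ S) → sepNum Φ x (L.prod x) ≤ L.length := by
  intro L
  induction L with
  | nil =>
    intro _
    simp [sepNum, hC.same x hx x hx]
  | cons s L ih =>
    intro hL
    obtain ⟨γ, l, hs⟩ := hC.simple s (hL s (by simp))
    have h1 := Cox.sepNum_simple hs hx
    have h2 := ih fun g hg => hL g (by simp [hg])
    have h3 : sepNum Φ (s x) (s (L.prod x)) = sepNum Φ x (L.prod x) :=
      sepNum_map hΦ hs.inWaff _ _
    have h4 := sepNum_triangle hΦ.finite (x := x) (z := s (L.prod x))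
      ((hC.reg x hx).map hΦ hs.inWaff)
    rw [List.prod_cons, Equiv.Perm.mul_apply, List.length_cons]
    omega

lemma Nset_empty_mem (hC : Cox Φ C S) {x y : E m} (hx : x ∈ C) (hy : Regular Φ y)
    (h : ∀ α ∈ Φ, ∀ k, 0 < aff α k x * aff α k y) : y ∈ C := by
  by_contra hcon
  obtain ⟨s, _, γ, l, hs, hneg⟩ := hC.sep y hy hcon
  have := h γ hs.mem l
  have := hs.pos x hx
  nlinarith

/-- reflecting in a simple separating wall -/
lemma Cox.descend (hΦ : IsRootSystem Φ) (hC : Cox Φ C S) {x y : E m} (hx : x ∈ C)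
    (hy : Regular Φ y) (hyC : y ∉ C) :
    ∃ s ∈ S, ∃ γ l, SimpleAff Φ C s γ l ∧ aff γ l y < 0 ∧ sepNum Φ x (s y) < sepNum Φ x y := by
  obtain ⟨s, hsS, γ, l, hs, hneg⟩ := hC.sep y hy hyC
  refine ⟨s, hsS, γ, l, hs, hneg, ?_⟩
  rw [hs.eq]
  exact sepNum_refl_lt hΦ.finite hΦ.reflect_mem hΦ.crystallographic hy hs.mem
    (mul_neg_of_pos_of_neg (hs.pos x hx) hneg) (hΦ.ne_zero _ hs.mem)

/-- An element of `⟨S⟩` mapping a point of `C` into `C` is trivial. -/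
lemma Cox.free (hΦ : IsRootSystem Φ) (hC : Cox Φ C S) {x : E m} (hx : x ∈ C) :
    ∀ (n : ℕ) (L : List (Equiv.Perm (E m))), L.length = n → (∀ g ∈ L, g ∈ S) →
      L.prod x ∈ C → L.prod = 1 := by
  intro n
  induction n using Nat.strong_induction_on with
  | _ n ih =>
    intro L hn hL hLC
    cases L with
    | nil => rfl
    | cons s L =>
      obtain ⟨γ, l, hs⟩ := hC.simple s (hL s (by simp))
      have hL' : ∀ g ∈ L, g ∈ S := fun g hg => hL g (by simp [hg])
      have h0 := hΦ.ne_zero _ hs.mem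
      have hneg : ∀ p, aff γ l (s p) = - aff γ l p := by
        intro p
        rw [hs.eq, aff_affRefl, inner_coroot_self h0]
        ring
      have h1 := hs.pos x hx
      have h2 := hs.pos _ hLC
      rw [List.prod_cons, Equiv.Perm.mul_apply, hneg] at h2
      obtain ⟨L', hL'S, hlen, heq⟩ := hC.exchange hΦ hx L hL' γ hs.mem l
        (mul_neg_of_pos_of_neg h1 (by linarith))
      rw [← hs.eq] at heq
      rw [List.prod_cons, heq]
      rw [List.prod_cons, heq] at hLC
      refine ih L'.length ?_ L' rfl hL'S hLC
      rw [← hn, List.length_cons]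
      omega

/-- Every reflection is a product of simple ones. -/
lemma Cox.refl_word (hΦ : IsRootSystem Φ) (hC : Cox Φ C S) {x : E m} (hx : x ∈ C) :
    ∀ (n : ℕ), ∀ α ∈ Φ, ∀ k : ℤ, sepNum Φ x (affRefl α k x) = n →
      affRefl α k ∈ Subgroup.closure S := by
  intro n
  induction n using Nat.strong_induction_on with
  | _ n ih =>
    intro α hα k hn
    have hxr := hC.reg x hx
    set t := affRefl α k with ht
    have htW : t ∈ Waff Φ := affRefl_mem hα k
    have hne : t x ∉ C := by
      intro hcon
      have h1 : aff α k x ≠ 0 := hxr _ ⟨α, hα, k, rfl⟩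
      have h2 : aff α k (t x) = - aff α k x := by
        rw [ht, aff_affRefl, inner_coroot_self (hΦ.ne_zero _ hα)]
        ring
      rcases lt_or_gt_of_ne h1 with h | h
      · have : aff α k ∈ Nset Φ (t x) x := ⟨⟨α, hα, k, rfl⟩, by linarith, h⟩
        rw [hC.same _ hcon _ hx] at this
        exact this
      · have : aff α k ∈ Nset Φ x (t x) := ⟨⟨α, hα, k, rfl⟩, h, by linarith⟩
        rw [hC.same _ hx _ hcon] at this
        exact this
    obtain ⟨s, hsS, γ, l, hs, hneg⟩ := hC.sep (t x) (hxr.map hΦ htW) hne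
    have hsW := hs.inWaff
    have hγ0 := hΦ.ne_zero _ hs.mem
    have hss : ∀ p, s (s p) = p := by
      intro p
      rw [hs.eq, affRefl_affRefl]
    have htt : ∀ p, t (t p) = p := fun p => affRefl_affRefl α k p
    have hsneg : ∀ p, aff γ l (s p) = - aff γ l p := by
      intro p
      rw [hs.eq, aff_affRefl, inner_coroot_self hγ0]
      ring
    have hpos := hs.pos x hx
    have haR : aff γ l ∈ AR Φ := ⟨γ, hs.mem, l, rfl⟩
    by_cases hts : t = s
    · rw [hts]; exact Subgroup.subset_closure hsS
    · -- `a (t s x) < 0`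
      have h1 : aff γ l (t (s x)) < 0 := by
        by_contra hcon
        have h2 : 0 < aff γ l (t (s x)) :=
          lt_of_le_of_ne (not_lt.mp hcon) ((hxr.map hΦ (mul_mem htW hsW)) _ haR).symm
        have h3 : -(aff γ l ∘ t) ∈ Nset Φ x (s x) := by
          refine ⟨AR_neg hΦ (AR_comp hΦ htW haR), ?_, ?_⟩
          · simp only [Pi.neg_apply, Function.comp]; linarith
          · simp only [Pi.neg_apply, Function.comp]; linarith
        have h4 := hs.only x hx _ h3
        apply hts
        rw [hs.eq]
        apply affRefl_congr_neg hγ0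
        intro y
        have := congrFun h4 y
        simp only [Pi.neg_apply, Function.comp] at this
        rw [← this, neg_neg]
      obtain ⟨α', hα', k', _, hconj⟩ := affRefl_conj hΦ hsW hα k
      have hs1 : s⁻¹ = s := inv_eq_of_mul_eq_one_left hs.mul_self
      rw [hs1] at hconj
      have hlt : sepNum Φ x (affRefl α' k' x) < n := by
        have e : sepNum Φ x (affRefl α' k' x) = sepNum Φ (s x) (t (s x)) := by
          rw [hconj, ← sepNum_map hΦ hsW x]
          simp only [Equiv.Perm.mul_apply, hss]
          rfl
        rw [e, ← hn]
        have hmem : aff γ l ∈ Nset Φ x (t x) := ⟨haR, hpos, hneg⟩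
        refine lt_of_le_of_lt (Set.ncard_le_ncard ?_
          ((Nset_finite hΦ.finite x (t x)).subset Set.sdiff_subset))
          (Set.ncard_sdiff_singleton_lt_of_mem hmem (Nset_finite hΦ.finite x (t x)))
        rintro b ⟨hb, hb1, hb2⟩
        refine ⟨⟨hb, ?_, ?_⟩, ?_⟩
        · by_contra hcon
          have h2 : b x < 0 := lt_of_le_of_ne (not_lt.mp hcon) (hxr b hb)
          have h3 := hs.only x hx (-b) ⟨AR_neg hΦ hb, by simpa using h2, by simpa using hb1⟩
          have h4 := congrFun h3 (t (s x))
          simp only [Pi.neg_apply] at h4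
          linarith
        · by_contra hcon
          have h2 : 0 < b (t x) :=
            lt_of_le_of_ne (not_lt.mp hcon) ((hxr.map hΦ htW) b hb).symm
          have h3 := hs.only x hx (b ∘ t) ⟨AR_comp hΦ htW hb, h2, hb2⟩
          have h4 := congrFun h3 (t (s x))
          simp only [Function.comp, htt] at h4
          linarith
        · rintro rfl
          rw [hsneg] at hb1
          linarith
      have hmem := ih _ hlt α' hα' k' rfl
      have : t = s * affRefl α' k' * s := by
        rw [hconj]
        have := hs.mul_self
        calc t = 1 * t * 1 := by simp
          _ = s * (s * t * s) * s := by rw [← hs.mul_self]; group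
      rw [this]
      have hsm := Subgroup.subset_closure (k := S) hsS
      exact mul_mem (mul_mem hsm hmem) hsm

lemma Cox.word (hΦ : IsRootSystem Φ) (hC : Cox Φ C S) {x : E m} (hx : x ∈ C)
    {w : Equiv.Perm (E m)} (hw : w ∈ Waff Φ) :
    ∃ L : List (Equiv.Perm (E m)), (∀ g ∈ L, g ∈ S) ∧ L.prod = w := by
  have h1 : w ∈ Subgroup.closure S := by
    refine (Subgroup.closure_le _).mpr ?_ hw
    rintro _ ⟨α, hα, k, rfl⟩
    exact hC.refl_word hΦ hx _ α hα k rfl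
  rw [← Subgroup.mem_toSubmonoid, Subgroup.closure_toSubmonoid] at h1
  obtain ⟨L, hL, hp⟩ := Submonoid.exists_list_of_mem_closure h1
  refine ⟨L, fun g hg => ?_, hp⟩
  rcases hL g hg with h | h
  · exact h
  · obtain ⟨γ, l, hs⟩ := hC.simple _ h
    have e : g⁻¹ = g := by
      have := hs.mul_self
      have h2 := inv_eq_of_mul_eq_one_left this
      rw [inv_inv] at h2
      exact h2.symm
    rwa [Set.mem_inv, e] at h

lemma Cox.short_word (hΦ : IsRootSystem Φ) (hC : Cox Φ C S) {x : E m} (hx : x ∈ C) :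
    ∀ (n : ℕ), ∀ w ∈ Waff Φ, sepNum Φ x (w x) = n →
    ∃ L : List (Equiv.Perm (E m)), (∀ g ∈ L, g ∈ S) ∧ L.length ≤ n ∧ L.prod = w := by
  intro n
  induction n using Nat.strong_induction_on with
  | _ n ih =>
    intro w hw hn
    by_cases hwC : w x ∈ C
    · obtain ⟨L, hL, hp⟩ := hC.word hΦ hx hw
      refine ⟨[], by simp, by simp, ?_⟩
      rw [← hp] at hwC ⊢
      exact (hC.free hΦ hx _ L rfl hL hwC).symm
    · obtain ⟨s, hsS, γ, l, hs, _, hlt⟩ := hC.descend hΦ hx ((hC.reg x hx).map hΦ hw) hwC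
      obtain ⟨L, hL, hlen, hp⟩ := ih _ (hn ▸ hlt) (s * w) (mul_mem hs.inWaff hw) rfl
      rw [Equiv.Perm.mul_apply] at hlen
      refine ⟨s :: L, ?_, ?_, ?_⟩
      · intro g hg
        rcases List.mem_cons.mp hg with rfl | hg
        · exact hsS
        · exact hL g hg
      · rw [List.length_cons]
        omega
      · rw [List.prod_cons, hp, ← mul_assoc, hs.mul_self, one_mul]

/-- The length is the number of separating walls. -/
lemma Cox.len_eq (hΦ : IsRootSystem Φ) (hC : Cox Φ C S) {x : E m} (hx : x ∈ C)
    {w : Equiv.Perm (E m)} (hw : w ∈ Waff Φ) : len S w = sepNum Φ x (w x) := by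
  obtain ⟨L, hL, hlen, hp⟩ := hC.short_word hΦ hx _ w hw rfl
  apply le_antisymm
  · refine (Nat.sInf_le (m := L.length) ?_).trans hlen
    exact ⟨L, hL, rfl, hp⟩
  · refine le_csInf ⟨_, L, hL, rfl, hp⟩ ?_
    rintro _ ⟨L', hL', rfl, rfl⟩
    exact hC.sepNum_le hΦ hx L' hL'

end cox
/-- A simple system with its coweights, in convenient form. -/
structure Base (Φ : Set (E m)) (Δ ω : Fin m → E m) : Prop where
  mem : ∀ j, Δ j ∈ Φ
  exp : ∀ v, v = ∑ l, ⟪v, ω l⟫ • Δ l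
  dual : ∀ i j, ⟪Δ i, ω j⟫ = if i = j then (1 : ℝ) else 0
  sign : ∀ β ∈ Φ, (∀ l, 0 ≤ ⟪β, ω l⟫) ∨ (∀ l, ⟪β, ω l⟫ ≤ 0)
  int : ∀ β ∈ Φ, ∀ l, ∃ z : ℤ, ⟪β, ω l⟫ = (z : ℝ)

lemma coeff_eq {B ω : Fin m → E m} (hω : IsFundamentalCoweights B ω) (c : Fin m → ℝ) (l : Fin m) :
    ⟪∑ j, c j • B j, ω l⟫ = c l := by
  rw [sum_inner]
  simp only [real_inner_smul_left, hω _ l]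
  simp

lemma base_of {Φ : Set (E m)} {B ω : Fin m → E m} (hB : IsSimpleSystem Φ B)
    (hω : IsFundamentalCoweights B ω) : Base Φ B ω where
  mem := hB.mem
  dual := hω
  exp := by
    intro v
    have hspan : ⊤ ≤ Submodule.span ℝ (Set.range B) := by
      rw [hB.indep.span_eq_top_of_card_eq_finrank']
      simp
    have hv : v ∈ Submodule.span ℝ (Set.range B) := hspan Submodule.mem_top
    obtain ⟨c, rfl⟩ := (Submodule.mem_span_range_iff_exists_fun ℝ).mp hv
    simp only [coeff_eq hω]
  sign := by
    intro β hβ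
    rcases hB.decomp β hβ with ⟨c, hc, h⟩ | ⟨c, hc, h⟩
    · left
      intro l
      rw [hc, coeff_eq hω (fun j => (c j : ℝ))]
      exact_mod_cast h l
    · right
      intro l
      rw [hc, coeff_eq hω (fun j => (c j : ℝ))]
      exact_mod_cast h l
  int := by
    intro β hβ l
    rcases hB.decomp β hβ with ⟨c, hc, h⟩ | ⟨c, hc, h⟩
    · exact ⟨c l, by rw [hc, coeff_eq hω (fun j => (c j : ℝ))]⟩
    · exact ⟨c l, by rw [hc, coeff_eq hω (fun j => (c j : ℝ))]⟩

section base
variable {Φ : Set (E m)} {Δ ω : Fin m → E m}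

lemma Base.neg (h : Base Φ Δ ω) (hΦ : IsRootSystem Φ) :
    Base Φ (fun j => -Δ j) (fun j => -ω j) where
  mem := fun j => neg_mem_root hΦ (h.mem j)
  exp := by
    intro v
    have := h.exp v
    simpa using this
  dual := by
    intro i j
    simpa using h.dual i j
  sign := by
    intro β hβ
    simp only [inner_neg_right]
    rcases h.sign β hβ with h | h
    · right; intro l; linarith [h l]
    · left; intro l; linarith [h l]
  int := by
    intro β hβ l
    obtain ⟨z, hz⟩ := h.int β hβ l
    exact ⟨-z, by simp [hz]⟩

lemma Base.ext_coeff (h : Base Φ Δ ω) {v v' : E m} (hv : ∀ l, ⟪v, ω l⟫ = ⟪v', ω l⟫) : v = v' := by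
  rw [h.exp v, h.exp v']
  simp only [hv]

lemma Base.inner_eq (h : Base Φ Δ ω) (v x : E m) : ⟪v, x⟫ = ∑ l, ⟪v, ω l⟫ * ⟪Δ l, x⟫ := by
  conv_lhs => rw [h.exp v]
  rw [sum_inner]
  simp only [real_inner_smul_left]

/-- A positive root other than `Δ j` stays positive under `s_j`. -/
lemma Base.refl_pos (h : Base Φ Δ ω) (hΦ : IsRootSystem Φ) {β : E m} (hβ : β ∈ Φ)
    (hpos : ∀ l, 0 ≤ ⟪β, ω l⟫) (j : Fin m) (hne : β ≠ Δ j) :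
    ∀ l, 0 ≤ ⟪β - ⟪Δ j, β⟫ • coroot (Δ j), ω l⟫ := by
  have hmem := hΦ.reflect_mem _ (h.mem j) β hβ
  have hoff : ∀ l, l ≠ j → ⟪β - ⟪Δ j, β⟫ • coroot (Δ j), ω l⟫ = ⟪β, ω l⟫ := by
    intro l hl
    unfold coroot
    rw [inner_sub_left, real_inner_smul_left, real_inner_smul_left, h.dual, if_neg hl.symm]
    ring
  have hex : ∃ l, l ≠ j ∧ ⟪β, ω l⟫ ≠ 0 := by
    by_contra hcon
    push Not at hcon
    have hb : β = ⟪β, ω j⟫ • Δ j := by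
      apply h.ext_coeff
      intro l
      rw [real_inner_smul_left, h.dual]
      by_cases hl : l = j
      · subst hl; simp
      · rw [hcon l hl, if_neg (Ne.symm hl)]; ring
    rcases hΦ.reduced _ (h.mem j) _ (hb ▸ hβ) with h1 | h1
    · rw [h1, one_smul] at hb
      exact hne hb
    · have := hpos j
      rw [h1] at this
      linarith
  obtain ⟨l, hl, hl0⟩ := hex
  rcases h.sign _ hmem with h1 | h1
  · exact h1
  · exfalso
    have h2 := h1 l
    rw [hoff l hl] at h2
    exact hl0 (le_antisymm h2 (hpos l))

/-- Coroots are integral combinations of simple coroots. -/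
lemma Base.coroot_pos (h : Base Φ Δ ω) (hΦ : IsRootSystem Φ) (i : Fin m) :
    ∀ (n : ℕ) (β : E m), β ∈ Φ → (∀ l, 0 ≤ ⟪β, ω l⟫) → (∑ l, ⟪β, ω l⟫ ≤ n) →
      ∃ z : ℤ, ⟪coroot β, ω i⟫ = z * ⟪coroot (Δ i), ω i⟫ := by
  intro n
  induction n with
  | zero =>
    intro β hβ hpos hn
    exfalso
    apply hΦ.ne_zero β hβ
    apply h.ext_coeff
    intro l
    have h1 : ∑ l, ⟪β, ω l⟫ = 0 :=
      le_antisymm (by simpa using hn) (Finset.sum_nonneg fun l _ => hpos l)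
    rw [(Finset.sum_eq_zero_iff_of_nonneg fun l _ => hpos l).mp h1 l (Finset.mem_univ l)]
    simp
  | succ n ih =>
    intro β hβ hpos hn
    have hsimple : ∀ j, ∃ z : ℤ, ⟪coroot (Δ j), ω i⟫ = z * ⟪coroot (Δ i), ω i⟫ := by
      intro j
      by_cases hj : j = i
      · subst hj; exact ⟨1, by simp⟩
      · refine ⟨0, ?_⟩
        unfold coroot
        rw [real_inner_smul_left, h.dual, if_neg hj]
        simp
    by_cases hs : ∃ j, β = Δ j
    · obtain ⟨j, rfl⟩ := hs
      exact hsimple j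
    · push Not at hs
      have h0 := hΦ.ne_zero β hβ
      obtain ⟨j, hj⟩ : ∃ j, 0 < ⟪Δ j, β⟫ := by
        by_contra hcon
        push Not at hcon
        have h1 : (0:ℝ) < ⟪β, β⟫ := real_inner_self_pos.mpr h0
        rw [h.inner_eq β β] at h1
        have : ∑ l, ⟪β, ω l⟫ * ⟪Δ l, β⟫ ≤ 0 :=
          Finset.sum_nonpos fun l _ => mul_nonpos_of_nonneg_of_nonpos (hpos l) (hcon l)
        linarith
      have hjj : (0:ℝ) < ⟪Δ j, Δ j⟫ := real_inner_self_pos.mpr (hΦ.ne_zero _ (h.mem j))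
      set β' := β - ⟪Δ j, β⟫ • coroot (Δ j) with hβ'
      have hmem : β' ∈ Φ := hΦ.reflect_mem _ (h.mem j) β hβ
      have hpos' := h.refl_pos hΦ hβ hpos j (hs j)
      obtain ⟨z, hz⟩ := hΦ.crystallographic β hβ _ (h.mem j)
      have hβ'' : β' = β - (z:ℝ) • Δ j := by
        rw [hβ', ← inner_coroot_mul, hz]
      have hzpos : (1:ℝ) ≤ z := by
        have : (0:ℝ) < z := by
          rw [← hz]
          unfold coroot
          rw [real_inner_smul_right, real_inner_comm (Δ j) β]
          positivity
        exact_mod_cast this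
      have hsum : ∑ l, ⟪β', ω l⟫ ≤ n := by
        have : ∑ l, ⟪β', ω l⟫ = ∑ l, ⟪β, ω l⟫ - z := by
          rw [hβ'']
          simp only [inner_sub_left, real_inner_smul_left, h.dual, Finset.sum_sub_distrib]
          simp
        rw [this]
        push_cast at hn
        linarith
      obtain ⟨y, hy⟩ := ih β' hmem hpos' hsum
      obtain ⟨z', hz'⟩ := hΦ.crystallographic _ (h.mem j) β hβ
      obtain ⟨y', hy'⟩ := hsimple j
      obtain ⟨u, hu, hu'⟩ := exists_linRefl (Δ j)
      have e1 : coroot β' = coroot β - (z':ℝ) • coroot (Δ j) := by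
        rw [hβ', ← hu, coroot_map, hu, hz']
      refine ⟨y + z' * y', ?_⟩
      have e2 : coroot β = coroot β' + (z':ℝ) • coroot (Δ j) := by rw [e1]; abel
      rw [e2, inner_add_left, real_inner_smul_left, hy, hy']
      push_cast
      ring

lemma Base.lattice (h : Base Φ Δ ω) (hΦ : IsRootSystem Φ) (i : Fin m) {v : E m}
    (hv : v ∈ corootLattice Φ) : ∃ z : ℤ, ⟪v, ω i⟫ = z * ⟪coroot (Δ i), ω i⟫ := by
  have key : ∀ β ∈ Φ, (∀ l, 0 ≤ ⟪β, ω l⟫) →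
      ∃ z : ℤ, ⟪coroot β, ω i⟫ = z * ⟪coroot (Δ i), ω i⟫ := by
    intro β hβ hpos
    obtain ⟨n, hn⟩ := exists_nat_ge (∑ l, ⟪β, ω l⟫)
    exact h.coroot_pos hΦ i n β hβ hpos hn
  induction hv using AddSubgroup.closure_induction with
  | mem x hx =>
    obtain ⟨β, hβ, rfl⟩ := hx
    rcases h.sign β hβ with h1 | h1
    · exact key β hβ h1
    · obtain ⟨z, hz⟩ := key (-β) (neg_mem_root hΦ hβ) (fun l => by
        rw [inner_neg_left]; linarith [h1 l])
      rw [coroot_neg, inner_neg_left] at hz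
      exact ⟨-z, by push_cast; linarith⟩
  | zero => exact ⟨0, by simp⟩
  | add x y _ _ hx hy =>
    obtain ⟨a, ha⟩ := hx
    obtain ⟨b, hb⟩ := hy
    exact ⟨a + b, by rw [inner_add_left, ha, hb]; push_cast; ring⟩
  | neg x _ hx =>
    obtain ⟨a, ha⟩ := hx
    exact ⟨-a, by rw [inner_neg_left, ha]; push_cast; ring⟩

/-- The fundamental alcove. -/
def alc (Δ : Fin m → E m) (θ : E m) : Set (E m) := {x | (∀ j, 0 < ⟪Δ j, x⟫) ∧ ⟪θ, x⟫ < 1}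

/-- The generating set attached to the alcove. -/
def Sgen (Δ : Fin m → E m) (θ : E m) : Set (Equiv.Perm (E m)) :=
  {w | (∃ i, w = affRefl (Δ i) 0) ∨ w = affRefl θ 1}

lemma Base.alc_pos (h : Base Φ Δ ω) {θ : E m} {x : E m} (hx : x ∈ alc Δ θ) {β : E m}
    (h0 : β ≠ 0) (hpos : ∀ l, 0 ≤ ⟪β, ω l⟫) : 0 < ⟪β, x⟫ := by
  rw [h.inner_eq β x]
  refine Finset.sum_pos' (fun l _ => mul_nonneg (hpos l) (hx.1 l).le) ?_
  by_contra hcon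
  push Not at hcon
  apply h0
  apply h.ext_coeff
  intro l
  have h1 := hcon l (Finset.mem_univ l)
  have h2 := hx.1 l
  rw [inner_zero_left]
  by_contra h3
  have h4 : 0 < ⟪β, ω l⟫ := lt_of_le_of_ne (hpos l) (Ne.symm h3)
  have := mul_pos h4 h2
  linarith

lemma Base.alc_le (h : Base Φ Δ ω) {θ : E m} {x : E m} (hx : x ∈ alc Δ θ) {β : E m}
    (hle : ∀ l, ⟪β, ω l⟫ ≤ ⟪θ, ω l⟫) : ⟪β, x⟫ ≤ ⟪θ, x⟫ := by
  rw [h.inner_eq β x, h.inner_eq θ x]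
  exact Finset.sum_le_sum fun l _ => mul_le_mul_of_nonneg_right (hle l) (hx.1 l).le

/-- Values of roots on the alcove. -/
lemma Base.alc_val (h : Base Φ Δ ω) (hΦ : IsRootSystem Φ) {θ : E m}
    (hθ : ∀ β ∈ Φ, ∀ l, ⟪β, ω l⟫ ≤ ⟪θ, ω l⟫) {x : E m} (hx : x ∈ alc Δ θ) {β : E m} (hβ : β ∈ Φ) :
    ((∀ l, 0 ≤ ⟪β, ω l⟫) ∧ 0 < ⟪β, x⟫ ∧ ⟪β, x⟫ < 1) ∨
    ((∀ l, 0 ≤ ⟪-β, ω l⟫) ∧ -1 < ⟪β, x⟫ ∧ ⟪β, x⟫ < 0) := by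
  rcases h.sign β hβ with h1 | h1
  · left
    exact ⟨h1, h.alc_pos hx (hΦ.ne_zero β hβ) h1, (h.alc_le hx (hθ β hβ)).trans_lt hx.2⟩
  · right
    have hneg := neg_mem_root hΦ hβ
    have h2 : ∀ l, 0 ≤ ⟪-β, ω l⟫ := fun l => by rw [inner_neg_left]; linarith [h1 l]
    have h3 := h.alc_pos hx (hΦ.ne_zero _ hneg) h2
    have h4 := (h.alc_le hx (hθ _ hneg)).trans_lt hx.2
    rw [inner_neg_left] at h3 h4
    exact ⟨h2, by linarith, by linarith⟩

/-- pairing of a positive root with the highest coroot -/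
lemma Base.high_pair (h : Base Φ Δ ω) (hΦ : IsRootSystem Φ) {θ : E m} (hθm : θ ∈ Φ)
    (hθ : ∀ β ∈ Φ, ∀ l, ⟪β, ω l⟫ ≤ ⟪θ, ω l⟫) {β : E m} (hβ : β ∈ Φ)
    (hpos : ∀ l, 0 ≤ ⟪β, ω l⟫) (hne : β ≠ θ) :
    ⟪β, coroot θ⟫ = (0:ℝ) ∨ ⟪β, coroot θ⟫ = (1:ℝ) := by
  obtain ⟨z, hz⟩ := hΦ.crystallographic β hβ θ hθm
  have hθ0 : (0:ℝ) < ⟪θ, θ⟫ := real_inner_self_pos.mpr (hΦ.ne_zero _ hθm)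
  have hβ0 : (0:ℝ) < ⟪β, β⟫ := real_inner_self_pos.mpr (hΦ.ne_zero _ hβ)
  have hθpos : ∀ l, 0 ≤ ⟪θ, ω l⟫ := fun l => (hpos l).trans (hθ β hβ l)
  have h0 : (0:ℝ) ≤ ⟪θ, β⟫ := by
    -- reflect `θ` in `β`
    have h1 := hΦ.reflect_mem β hβ θ hθm
    obtain ⟨l, hl⟩ : ∃ l, ⟪β, ω l⟫ ≠ 0 := by
      by_contra hcon
      push Not at hcon
      exact hΦ.ne_zero β hβ (h.ext_coeff fun l => by rw [hcon l, inner_zero_left])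
    have hl' : 0 < ⟪β, ω l⟫ := lt_of_le_of_ne (hpos l) (Ne.symm hl)
    have h2 := hθ _ h1 l
    unfold coroot at h2
    rw [inner_sub_left, real_inner_smul_left, real_inner_smul_left] at h2
    have h3 : 0 ≤ ⟪β, θ⟫ * (2 / ⟪β, β⟫ * ⟪β, ω l⟫) := by linarith
    rw [real_inner_comm]
    exact nonneg_of_mul_nonneg_left h3 (by positivity)
  have hz0 : (0:ℝ) ≤ z := by
    rw [← hz]
    unfold coroot
    rw [real_inner_smul_right, real_inner_comm θ β]
    positivity
  have hz1 : (z:ℝ) < 2 := by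
    by_contra hcon
    push Not at hcon
    apply hne
    apply h.ext_coeff
    intro l
    apply le_antisymm (hθ β hβ l)
    have h1 := neg_mem_root hΦ (hΦ.reflect_mem θ hθm β hβ)
    have h2 := hθ _ h1 l
    rw [← inner_coroot_mul, hz, inner_neg_left, inner_sub_left, real_inner_smul_left] at h2
    have h3 := mul_nonneg (sub_nonneg.mpr hcon) (hθpos l)
    linarith
  rw [hz]
  have a : 0 ≤ z := by exact_mod_cast hz0
  have b : z < 2 := by exact_mod_cast hz1
  interval_cases z
  · left; simp
  · right; simp

lemma Base.simple_j (h : Base Φ Δ ω) (hΦ : IsRootSystem Φ) {θ : E m}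
    (hθ : ∀ β ∈ Φ, ∀ l, ⟪β, ω l⟫ ≤ ⟪θ, ω l⟫) (j : Fin m) :
    SimpleAff Φ (alc Δ θ) (affRefl (Δ j) 0) (Δ j) 0 where
  mem := h.mem j
  eq := rfl
  pos := by
    intro x hx
    simpa [aff] using hx.1 j
  only := by
    rintro x hx _ ⟨⟨β, hβ, k, rfl⟩, h1, h2⟩
    obtain ⟨z, hz⟩ := hΦ.crystallographic β hβ _ (h.mem j)
    have hj1 : ⟪Δ j, x⟫ < 1 := (h.alc_le hx (hθ _ (h.mem j))).trans_lt hx.2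
    have hj0 := hx.1 j
    have hΔ0 := hΦ.ne_zero _ (h.mem j)
    by_cases e1 : β = Δ j
    · subst e1
      rw [aff_affRefl, inner_coroot_self hΔ0] at h2
      simp only [aff, Int.cast_zero] at h1 h2
      have a1 : (k:ℝ) < 1 := by linarith
      have a2 : (-1:ℝ) < k := by linarith
      have b1 : k < 1 := by exact_mod_cast a1
      have b2 : -1 < k := by exact_mod_cast a2
      have : k = 0 := by omega
      rw [this]
    by_cases e2 : β = - Δ j
    · exfalso
      subst e2
      rw [aff_affRefl, inner_neg_left, inner_coroot_self hΔ0] at h2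
      simp only [aff, Int.cast_zero, inner_neg_left] at h1 h2
      linarith
    exfalso
    rw [aff_comp_refl hz] at h2
    set β' := β - ⟪Δ j, β⟫ • coroot (Δ j) with hβ'
    have hmem : β' ∈ Φ := hΦ.reflect_mem _ (h.mem j) β hβ
    simp only [aff, zero_mul, sub_zero] at h1 h2
    rcases h.alc_val hΦ hθ hx hβ with ⟨p, p1, p2⟩ | ⟨p, p1, p2⟩
    · have q := h.refl_pos hΦ hβ p j e1
      have q1 := h.alc_pos hx (hΦ.ne_zero _ hmem) q
      have a1 : (k:ℝ) < 1 := by linarith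
      have a2 : (0:ℝ) < k := by linarith
      have b1 : k < 1 := by exact_mod_cast a1
      have b2 : 0 < k := by exact_mod_cast a2
      omega
    · have q := h.refl_pos hΦ (neg_mem_root hΦ hβ) p j (fun e => e2 (by rw [← e, neg_neg]))
      have e : -β - ⟪Δ j, -β⟫ • coroot (Δ j) = -β' := by
        rw [hβ', inner_neg_right, neg_smul]; abel
      rw [e] at q
      have hmem' := neg_mem_root hΦ hmem
      have q1 := (h.alc_le hx (hθ _ hmem')).trans_lt hx.2
      rw [inner_neg_left] at q1
      have a1 : (k:ℝ) < 0 := by linarith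
      have a2 : (-1:ℝ) < k := by linarith
      have b1 : k < 0 := by exact_mod_cast a1
      have b2 : -1 < k := by exact_mod_cast a2
      omega

lemma Base.simple_0 (h : Base Φ Δ ω) (hΦ : IsRootSystem Φ) {θ : E m} (hθm : θ ∈ Φ)
    (hθ : ∀ β ∈ Φ, ∀ l, ⟪β, ω l⟫ ≤ ⟪θ, ω l⟫) :
    SimpleAff Φ (alc Δ θ) (affRefl θ 1) (-θ) (-1) where
  mem := neg_mem_root hΦ hθm
  eq := (affRefl_neg θ 1).symm
  pos := by
    intro x hx
    simp only [aff, inner_neg_left]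
    push_cast
    linarith [hx.2]
  only := by
    rintro x hx _ ⟨⟨β, hβ, k, rfl⟩, h1, h2⟩
    have hθ0 := hΦ.ne_zero _ hθm
    have hx2 := hx.2
    have hθpos : 0 < ⟪θ, x⟫ := by
      rcases h.alc_val hΦ hθ hx hθm with ⟨_, p, _⟩ | ⟨p, _, _⟩
      · exact p
      · exfalso
        apply hθ0
        apply h.ext_coeff
        intro l
        have p1 := p l
        have p2 := hθ _ (neg_mem_root hΦ hθm) l
        rw [inner_neg_left] at p1 p2
        rw [inner_zero_left]
        linarith
    by_cases e2 : β = -θ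
    · subst e2
      rw [aff_affRefl, inner_neg_left, inner_coroot_self hθ0] at h2
      simp only [aff, inner_neg_left] at h1 h2
      push_cast at h2
      have a1 : (k:ℝ) < 0 := by linarith
      have a2 : (-2:ℝ) < k := by linarith
      have b1 : k < 0 := by exact_mod_cast a1
      have b2 : -2 < k := by exact_mod_cast a2
      have : k = -1 := by omega
      rw [this]
    exfalso
    by_cases e1 : β = θ
    · subst e1
      rw [aff_affRefl, inner_coroot_self hθ0] at h2
      simp only [aff] at h1 h2
      push_cast at h2
      linarith
    rw [aff_affRefl] at h2
    simp only [aff] at h1 h2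
    push_cast at h2
    rcases h.alc_val hΦ hθ hx hβ with ⟨p, p1, p2⟩ | ⟨p, p1, p2⟩
    · rcases h.high_pair hΦ hθm hθ hβ p e1 with q | q
      · rw [q] at h2; linarith
      · rw [q] at h2
        have a1 : (k:ℝ) < 1 := by linarith
        have a2 : (0:ℝ) < k := by linarith
        have b1 : k < 1 := by exact_mod_cast a1
        have b2 : 0 < k := by exact_mod_cast a2
        omega
    · have hneg := neg_mem_root hΦ hβ
      have hle := h.alc_le hx (hθ _ hneg)
      rw [inner_neg_left] at hle
      rcases h.high_pair hΦ hθm hθ hneg p (fun e => e2 (by rw [← e, neg_neg])) with q | q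
      · rw [inner_neg_left] at q
        rw [show ⟪β, coroot θ⟫ = (0:ℝ) by linarith] at h2
        linarith
      · rw [inner_neg_left] at q
        rw [show ⟪β, coroot θ⟫ = (-1:ℝ) by linarith] at h2
        have a1 : (k:ℝ) < 0 := by linarith
        have a2 : (-1:ℝ) < k := by linarith
        have b1 : k < 0 := by exact_mod_cast a1
        have b2 : -1 < k := by exact_mod_cast a2
        omega

lemma Base.cox (h : Base Φ Δ ω) (hΦ : IsRootSystem Φ) {θ : E m} (hθm : θ ∈ Φ)
    (hθ : ∀ β ∈ Φ, ∀ l, ⟪β, ω l⟫ ≤ ⟪θ, ω l⟫) : Cox Φ (alc Δ θ) (Sgen Δ θ) where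
  simple := by
    rintro s (⟨j, rfl⟩ | rfl)
    · exact ⟨_, _, h.simple_j hΦ hθ j⟩
    · exact ⟨_, _, h.simple_0 hΦ hθm hθ⟩
  sep := by
    intro y hy hyC
    by_cases h1 : ∃ j, ⟪Δ j, y⟫ < 0
    · obtain ⟨j, hj⟩ := h1
      exact ⟨_, Or.inl ⟨j, rfl⟩, _, _, h.simple_j hΦ hθ j, by simpa [aff] using hj⟩
    · push Not at h1
      refine ⟨_, Or.inr rfl, _, _, h.simple_0 hΦ hθm hθ, ?_⟩
      by_contra hcon
      have hne : aff (-θ) (-1) y ≠ 0 := hy _ ⟨-θ, neg_mem_root hΦ hθm, -1, rfl⟩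
      have hlt : 0 < aff (-θ) (-1) y := lt_of_le_of_ne (not_lt.mp hcon) hne.symm
      apply hyC
      refine ⟨fun j => ?_, ?_⟩
      · refine lt_of_le_of_ne (h1 j) ?_
        have := hy _ ⟨Δ j, h.mem j, 0, rfl⟩
        simp only [aff, Int.cast_zero, sub_zero] at this
        exact this.symm
      · simp only [aff, inner_neg_left] at hlt
        push_cast at hlt
        linarith
  reg := by
    rintro x hx _ ⟨β, hβ, k, rfl⟩ h0
    simp only [aff] at h0
    have hk : ⟪β, x⟫ = (k:ℝ) := by linarith
    rcases h.alc_val hΦ hθ hx hβ with ⟨p, p1, p2⟩ | ⟨p, p1, p2⟩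
    · rw [hk] at p1 p2
      have b1 : 0 < k := by exact_mod_cast p1
      have b2 : k < 1 := by exact_mod_cast p2
      omega
    · rw [hk] at p1 p2
      have b1 : -1 < k := by exact_mod_cast p1
      have b2 : k < 0 := by exact_mod_cast p2
      omega
  same := by
    intro x hx y hy
    rw [Set.eq_empty_iff_forall_notMem]
    rintro _ ⟨⟨β, hβ, k, rfl⟩, h1, h2⟩
    simp only [aff] at h1 h2
    rcases h.sign β hβ with p | p
    · have p1 := h.alc_pos hy (hΦ.ne_zero β hβ) p
      have p2 := (h.alc_le hx (hθ β hβ)).trans_lt hx.2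
      have b1 : (0:ℝ) < k := by linarith
      have b2 : (k:ℝ) < 1 := by linarith
      have b1 : 0 < k := by exact_mod_cast b1
      have b2 : k < 1 := by exact_mod_cast b2
      omega
    · have hneg := neg_mem_root hΦ hβ
      have p1 := h.alc_pos hx (hΦ.ne_zero _ hneg) (fun l => by
        rw [inner_neg_left]; linarith [p l])
      have p2 := (h.alc_le hy (hθ _ hneg)).trans_lt hy.2
      rw [inner_neg_left] at p1 p2
      have b1 : (k:ℝ) < 0 := by linarith
      have b2 : (-1:ℝ) < k := by linarith
      have b1 : k < 0 := by exact_mod_cast b1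
      have b2 : -1 < k := by exact_mod_cast b2
      omega

lemma Base.alc_nonempty (h : Base Φ Δ ω) {θ : E m} (hθ : ∀ l, 0 ≤ ⟪θ, ω l⟫) :
    (alc Δ θ).Nonempty := by
  set s : ℝ := ∑ l, ⟪θ, ω l⟫ with hs
  have hs0 : 0 ≤ s := Finset.sum_nonneg fun l _ => hθ l
  have hΔ : ∀ j, ⟪Δ j, (1 / (s + 1)) • ∑ l, ω l⟫ = 1 / (s + 1) := by
    intro j
    rw [real_inner_smul_right, inner_sum]
    simp only [h.dual]
    simp
  refine ⟨(1 / (s + 1)) • ∑ l, ω l, fun j => ?_, ?_⟩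
  · rw [hΔ]; positivity
  · rw [real_inner_smul_right, inner_sum, ← hs, one_div, inv_mul_lt_iff₀ (by positivity)]
    linarith

end base
/-- Roots orthogonal to `β`. -/
def perp (Φ : Set (E m)) (β : E m) : Set (E m) := {α ∈ Φ | ⟪α, β⟫ = (0:ℝ)}

/-- The points not separated from `x` by any wall of `Ψ`. -/
def cell (Ψ : Set (E m)) (x : E m) : Set (E m) :=
  {y | ∀ α ∈ Ψ, ∀ k : ℤ, 0 < aff α k x * aff α k y}

lemma aff_comb (α : E m) (k : ℤ) (y z : E m) (a b : ℝ) (hab : a + b = 1) :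
    aff α k (a • y + b • z) = a * aff α k y + b * aff α k z := by
  simp only [aff, inner_add_right, real_inner_smul_right]
  linear_combination (k : ℝ) * (hab)

lemma cell_convex (Ψ : Set (E m)) (x : E m) : Convex ℝ (cell Ψ x) := by
  intro y hy z hz a b ha hb hab α hα k
  rw [aff_comb _ _ _ _ _ _ hab]
  have h1 := hy α hα k
  have h2 := hz α hα k
  rcases ha.eq_or_lt with rfl | ha
  · have : b = 1 := by linarith
    subst this
    simpa using h2
  · have := mul_pos ha h1
    have := mul_nonneg hb h2.le
    nlinarith

lemma cell_translate {Φ : Set (E m)} {β x y : E m} (hy : y ∈ cell (perp Φ β) x) (t : ℝ) :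
    y + t • β ∈ cell (perp Φ β) x := by
  intro α hα k
  have h := hy α hα k
  have e : aff α k (y + t • β) = aff α k y := by
    simp only [aff, inner_add_right, real_inner_smul_right, hα.2]
    ring
  rwa [e]

lemma self_mem_cell {Ψ : Set (E m)} {x : E m} (hx : Regular Ψ x) : x ∈ cell Ψ x := by
  intro α hα k
  exact mul_self_pos.mpr (hx _ ⟨α, hα, k, rfl⟩)

lemma cell_regular {Ψ : Set (E m)} {x y : E m} (hy : y ∈ cell Ψ x) : Regular Ψ y := by
  rintro _ ⟨α, hα, k, rfl⟩ h0
  have := hy α hα k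
  rw [h0] at this
  simp at this

lemma mem_tubeWalls {Φ : Set (E m)} {β x : E m} :
    x ∈ tubeWalls Φ β ↔ ∃ α ∈ perp Φ β, ∃ k : ℤ, aff α k x = 0 := by
  simp only [tubeWalls, Set.mem_iUnion, wall, aff, sub_eq_zero, perp]
  simp

lemma tube_eq {Φ : Set (E m)} {β : E m} {T : Set (E m)} (hT : IsGeodesicTube Φ β T) :
    ∃ x, Regular (perp Φ β) x ∧ T = cell (perp Φ β) x := by
  obtain ⟨x, hx, rfl⟩ := hT
  have hreg : ∀ y, y ∈ (tubeWalls Φ β)ᶜ ↔ Regular (perp Φ β) y := by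
    intro y
    rw [Set.mem_compl_iff, mem_tubeWalls]
    constructor
    · rintro h _ ⟨α, hα, k, rfl⟩ h0
      exact h ⟨α, hα, k, h0⟩
    · rintro h ⟨α, hα, k, h0⟩
      exact h _ ⟨α, hα, k, rfl⟩ h0
  have hxr := (hreg x).mp hx
  refine ⟨x, hxr, ?_⟩
  apply Set.Subset.antisymm
  · intro y hy α hα k
    by_contra hcon
    have hxT := mem_connectedComponentIn hx
    have hy' := (hreg y).mp (connectedComponentIn_subset _ _ hy)
    have h1 : aff α k x * aff α k y < 0 := lt_of_le_of_ne (not_lt.mp hcon)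
      (mul_ne_zero (hxr _ ⟨α, hα, k, rfl⟩) (hy' _ ⟨α, hα, k, rfl⟩))
    have hcont : ∀ s, ContinuousOn (aff α k) s := by
      intro s
      unfold aff
      fun_prop
    have hz : ∃ z ∈ connectedComponentIn (tubeWalls Φ β)ᶜ x, aff α k z = 0 := by
      rcases mul_neg_iff.mp h1 with ⟨a, b⟩ | ⟨a, b⟩
      · exact isPreconnected_connectedComponentIn.intermediate_value₂ hy hxT (hcont _)
          (continuousOn_const (c := (0:ℝ))) b.le a.le
      · exact isPreconnected_connectedComponentIn.intermediate_value₂ hxT hy (hcont _)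
          (continuousOn_const (c := (0:ℝ))) a.le b.le
    obtain ⟨z, hz, hz0⟩ := hz
    exact (hreg z).mp (connectedComponentIn_subset _ _ hz) _ ⟨α, hα, k, rfl⟩ hz0
  · exact (cell_convex _ x).isPreconnected.subset_connectedComponentIn (self_mem_cell hxr)
      fun y hy => (hreg y).mpr (cell_regular hy)

section tube
variable {Φ : Set (E m)} {Δ ω : Fin m → E m}

lemma perp_refl (hΦ : IsRootSystem Φ) (β : E m) :
    ∀ α ∈ perp Φ β, ∀ γ ∈ perp Φ β, γ - ⟪α, γ⟫ • coroot α ∈ perp Φ β := by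
  intro α hα γ hγ
  refine ⟨hΦ.reflect_mem α hα.1 γ hγ.1, ?_⟩
  unfold coroot
  rw [inner_sub_left, real_inner_smul_left, real_inner_smul_left, hα.2, hγ.2]
  ring

/-- pull back for orthogonal roots -/
lemma IsRep.pull_perp (hΦ : IsRootSystem Φ) {w : Equiv.Perm (E m)} {u : E m ≃ₗᵢ[ℝ] E m} {v β : E m}
    (h : IsRep Φ w u v) (hu : u β = β) {α : E m} (hα : α ∈ perp Φ β) (k : ℤ) :
    ∃ α' ∈ perp Φ β, ∃ k' : ℤ, ∀ y, aff α k (w y) = aff α' k' y := by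
  obtain ⟨k', hk⟩ := h.pull hΦ hα.1 k
  refine ⟨u.symm α, ⟨h.symm_mem α hα.1, ?_⟩, k', hk⟩
  have := u.inner_map_map (u.symm α) β
  rw [u.apply_symm_apply, hu, hα.2] at this
  exact this.symm

lemma cell_map (hΦ : IsRootSystem Φ) {w : Equiv.Perm (E m)} {u : E m ≃ₗᵢ[ℝ] E m} {v β : E m}
    (h : IsRep Φ w u v) (hu : u β = β) {x : E m} (hx : w x ∈ cell (perp Φ β) x) {y : E m}
    (hy : y ∈ cell (perp Φ β) x) : w y ∈ cell (perp Φ β) x := by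
  intro α hα k
  obtain ⟨α', hα', k', hk⟩ := h.pull_perp hΦ hu hα k
  have h1 := hx α hα k
  have h2 := hy α' hα' k'
  rw [← hk, ← hk] at h2
  have h3 := mul_pos h1 h2
  by_contra hcon
  push Not at hcon
  have := mul_nonneg (sq_nonneg (aff α k (w x))) (neg_nonneg.mpr hcon)
  nlinarith

lemma cell_image (hΦ : IsRootSystem Φ) {w : Equiv.Perm (E m)} {u : E m ≃ₗᵢ[ℝ] E m} {v β : E m}
    (h : IsRep Φ w u v) (hu : u β = β) {x : E m} (hxr : Regular (perp Φ β) x)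
    (hx : w x ∈ cell (perp Φ β) x) :
    (w : E m → E m) '' cell (perp Φ β) x = cell (perp Φ β) x := by
  have hu' : u.symm β = β := by rw [LinearIsometryEquiv.symm_apply_eq, hu]
  have hx' : w⁻¹ x ∈ cell (perp Φ β) x := by
    intro α hα k
    obtain ⟨α', hα', k', hk⟩ := h.inv.pull_perp hΦ hu' hα k
    have h1 := hx α' hα' k'
    have e : aff α k x = aff α' k' (w x) := by simpa using hk (w x)
    rw [e, hk, mul_comm]
    exact h1
  apply Set.Subset.antisymm
  · rintro _ ⟨y, hy, rfl⟩
    exact cell_map hΦ h hu hx hy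
  · intro y hy
    exact ⟨w⁻¹ y, cell_map hΦ h.inv hu' hx' hy, by simp⟩

lemma IsRep.pow {w : Equiv.Perm (E m)} {u : E m ≃ₗᵢ[ℝ] E m} {v : E m}
    (h : IsRep Φ w u v) (n : ℕ) : ∃ v', IsRep Φ (w ^ n) (u ^ n) v' := by
  induction n with
  | zero => exact ⟨0, IsRep.one⟩
  | succ n ih =>
    obtain ⟨v', h'⟩ := ih
    rw [pow_succ, pow_succ]
    exact ⟨_, h'.mul h⟩

lemma IsRep.finOrder (hΦ : IsRootSystem Φ) {w : Equiv.Perm (E m)} {u : E m ≃ₗᵢ[ℝ] E m} {v : E m}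
    (h : IsRep Φ w u v) : ∃ N : ℕ, 0 < N ∧ ∀ x, (u ^ N) x = x := by
  haveI : Finite Φ := hΦ.finite
  let σ : Equiv.Perm Φ :=
    { toFun := fun α => ⟨u α, h.mem α α.2⟩
      invFun := fun α => ⟨u.symm α, h.symm_mem α α.2⟩
      left_inv := fun α => by simp
      right_inv := fun α => by simp }
  have hσ : ∀ (n : ℕ) (α : Φ), (((σ ^ n) α : Φ) : E m) = (u ^ n) α := by
    intro n
    induction n with
    | zero => intro α; rfl
    | succ n ih =>
      intro α
      rw [pow_succ, pow_succ, Equiv.Perm.mul_apply, ih]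
      rfl
  refine ⟨orderOf σ, orderOf_pos σ, ?_⟩
  have h1 : ∀ α ∈ Φ, (u ^ orderOf σ) α = α := by
    intro α hα
    have := hσ (orderOf σ) ⟨α, hα⟩
    rw [pow_orderOf_eq_one] at this
    exact this.symm
  have h2 : ((u ^ orderOf σ).toLinearEquiv : E m →ₗ[ℝ] E m) = LinearMap.id := by
    apply LinearMap.ext_on hΦ.span_eq_top
    intro α hα
    exact h1 α hα
  intro x
  exact LinearMap.congr_fun h2 x

lemma image_pow {T : Set (E m)} {w : Equiv.Perm (E m)} (hT : (w : E m → E m) '' T = T) {y : E m}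
    (hy : y ∈ T) (n : ℕ) : (w ^ n) y ∈ T := by
  induction n with
  | zero => exact hy
  | succ n ih =>
    rw [pow_succ', Equiv.Perm.mul_apply]
    rw [← hT]
    exact ⟨_, ih, rfl⟩

/-- A tube-stabilizing element translates some line in the tube. -/
lemma fixed_line (hΦ : IsRootSystem Φ) (hB : Base Φ Δ ω) (i : Fin m) {w : Equiv.Perm (E m)}
    {u : E m ≃ₗᵢ[ℝ] E m} {v : E m} (h : IsRep Φ w u v) (hu : u (ω i) = ω i) {x : E m}
    (hxr : Regular (perp Φ (ω i)) x)
    (hT : (w : E m → E m) '' cell (perp Φ (ω i)) x = cell (perp Φ (ω i)) x) :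
    ∃ x0 ∈ cell (perp Φ (ω i)) x, ∃ μ : ℝ, w x0 = x0 + μ • ω i := by
  set T := cell (perp Φ (ω i)) x with hTdef
  have hxT : x ∈ T := self_mem_cell hxr
  obtain ⟨N, hN, hNu⟩ := h.finOrder hΦ
  obtain ⟨v', h'⟩ := h.pow N
  have hw : ∀ y, (w ^ N) y = y + v' := fun y => by rw [h'.eq, hNu]
  -- iterates of the translation stay in `T`
  have hit : ∀ n : ℕ, x + (n:ℝ) • v' ∈ T := by
    intro n
    have e : ∀ n : ℕ, ((w ^ N) ^ n) x = x + (n:ℝ) • v' := by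
      intro n
      induction n with
      | zero => simp
      | succ n ih =>
        rw [pow_succ', Equiv.Perm.mul_apply, ih, hw]
        push_cast
        module
    rw [← e, ← pow_mul]
    exact image_pow hT hxT _
  have hbdd : ∀ y ∈ T, ∀ α ∈ perp Φ (ω i), |⟪α, y⟫ - ⟪α, x⟫| ≤ 1 := by
    intro y hy α hα
    have h1 := hy α hα ⌊⟪α, x⟫⌋
    have h2 := hy α hα (⌊⟪α, x⟫⌋ + 1)
    have f1 := Int.floor_le ⟪α, x⟫
    have f2 := Int.lt_floor_add_one ⟪α, x⟫
    simp only [aff] at h1 h2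
    push_cast at h2
    have g1 : 0 < ⟪α, y⟫ - (⌊⟪α, x⟫⌋ : ℝ) := by
      by_contra hcon
      nlinarith
    have g2 : ⟪α, y⟫ - ((⌊⟪α, x⟫⌋ : ℝ) + 1) < 0 := by
      by_contra hcon
      nlinarith
    rw [abs_le]
    constructor <;> linarith
  have horth : ∀ α ∈ perp Φ (ω i), ⟪α, v'⟫ = (0:ℝ) := by
    intro α hα
    by_contra hne
    obtain ⟨n, hn⟩ := exists_nat_gt (1 / |⟪α, v'⟫|)
    have h1 := hbdd _ (hit n) α hα
    rw [inner_add_right, real_inner_smul_right, add_sub_cancel_left, abs_mul, Nat.abs_cast] at h1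
    rw [div_lt_iff₀ (abs_pos.mpr hne)] at hn
    linarith
  have hv' : v' = ⟪Δ i, v'⟫ • ω i := by
    rw [← sub_eq_zero]
    rw [← inner_self_eq_zero (𝕜 := ℝ), hB.inner_eq]
    apply Finset.sum_eq_zero
    intro l _
    have : ⟪Δ l, v' - ⟪Δ i, v'⟫ • ω i⟫ = (0:ℝ) := by
      rw [inner_sub_right, real_inner_smul_right, hB.dual]
      by_cases hl : l = i
      · subst hl; simp
      · rw [if_neg hl, horth (Δ l) ⟨hB.mem l, by rw [hB.dual, if_neg hl]⟩]
        ring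
    rw [this, mul_zero]
  set μ : ℝ := ⟪Δ i, v'⟫ / N with hμ
  have hN0 : (N:ℝ) ≠ 0 := by exact_mod_cast hN.ne'
  have hv'' : v' = ((N:ℝ) * μ) • ω i := by
    rw [hμ, mul_div_cancel₀ _ hN0]
    exact hv'
  set f : ℕ → E m := fun n => (w ^ n) x - ((n:ℝ) * μ) • ω i with hf
  have hfT : ∀ n, f n ∈ T := by
    intro n
    have := cell_translate (image_pow hT hxT n) (-((n:ℝ) * μ))
    rw [neg_smul, ← sub_eq_add_neg] at this
    exact this
  have hfs : ∀ n, u (f n) + v = f (n + 1) + μ • ω i := by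
    intro n
    simp only [hf]
    rw [map_sub, map_smul, hu, pow_succ', Equiv.Perm.mul_apply, h.eq]
    push_cast
    module
  have hfN : f N = f 0 := by
    simp only [hf]
    rw [hw, hv'']
    simp
  refine ⟨∑ n ∈ Finset.range N, (N:ℝ)⁻¹ • f n, ?_, μ, ?_⟩
  · refine (cell_convex _ x).sum_mem (fun _ _ => by positivity) ?_ (fun n _ => hfT n)
    rw [Finset.sum_const, Finset.card_range, nsmul_eq_mul, mul_inv_cancel₀ hN0]
  · rw [h.eq, ← Finset.smul_sum, map_smul, map_sum]
    have e1 : ∑ n ∈ Finset.range N, u (f n) =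
        ∑ n ∈ Finset.range N, f n + ((N:ℝ) • (μ • ω i - v)) := by
      have e2 : ∀ n, u (f n) = f (n + 1) + (μ • ω i - v) := by
        intro n
        have := hfs n
        rw [← add_sub_assoc, ← this]
        abel
      simp only [e2]
      rw [Finset.sum_add_distrib, Finset.sum_const, Finset.card_range, ← Nat.cast_smul_eq_nsmul ℝ]
      congr 1
      have a1 := Finset.sum_range_succ f N
      have a2 := Finset.sum_range_succ' f N
      rw [hfN] at a1
      rw [a1] at a2
      exact (add_right_cancel a2).symm
    rw [e1, smul_add, smul_smul, inv_mul_cancel₀ hN0, one_smul]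
    abel

/-- displacement along `β` -/
lemma IsRep.disp {w : Equiv.Perm (E m)} {u : E m ≃ₗᵢ[ℝ] E m} {v β : E m}
    (h : IsRep Φ w u v) (hu : u β = β) (y : E m) : ⟪w y - y, β⟫ = ⟪v, β⟫ := by
  have := u.inner_map_map y β
  rw [hu] at this
  rw [h.eq, inner_sub_left, inner_add_left, this]
  ring

/-- hyperbolicity criterion -/
lemma hyperbolic_of {w : Equiv.Perm (E m)} {u : E m ≃ₗᵢ[ℝ] E m} {v β : E m}
    (h : IsRep Φ w u v) (hu : u β = β) (hβ : β ≠ 0) {x0 : E m} {μ : ℝ} (hμ : 0 < μ)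
    (hx0 : w x0 = x0 + μ • β) :
    IsHyperbolic (w : E m → E m) ∧ HasTransVec (w : E m → E m) (μ • β) := by
  have hββ : ⟪β, β⟫ = ‖β‖ ^ 2 := real_inner_self_eq_norm_sq β
  have hn : 0 < ‖β‖ := norm_pos_iff.mpr hβ
  have hv : ⟪v, β⟫ = μ * ‖β‖ ^ 2 := by
    rw [← h.disp hu x0, hx0, add_sub_cancel_left, real_inner_smul_left, hββ]
  have hd : ∀ y, ⟪w y - y, β⟫ = μ * ‖β‖ ^ 2 := fun y => by rw [h.disp hu, hv]
  have hlow : ∀ y, μ * ‖β‖ ≤ dist y (w y) := by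
    intro y
    rw [dist_comm, dist_eq_norm]
    have h1 := real_inner_le_norm (w y - y) β
    rw [hd, sq, ← mul_assoc] at h1
    exact le_of_mul_le_mul_right h1 hn
  have hx0d : dist x0 (w x0) = μ * ‖β‖ := by
    rw [hx0, dist_comm, dist_eq_norm, add_sub_cancel_left, norm_smul, Real.norm_of_nonneg hμ.le]
  have hmin : minDisp (w : E m → E m) = μ * ‖β‖ := by
    apply le_antisymm
    · rw [← hx0d]
      exact ciInf_le ⟨0, by rintro _ ⟨y, rfl⟩; exact dist_nonneg⟩ x0
    · exact le_ciInf hlow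
  refine ⟨⟨⟨x0, by rw [minSet, Set.mem_setOf_eq, hmin, hx0d]⟩, by rw [hmin]; positivity⟩, ?_⟩
  intro y hy
  rw [minSet, Set.mem_setOf_eq, hmin, dist_comm, dist_eq_norm] at hy
  have h1 : ‖(w y - y) - μ • β‖ ^ 2 = 0 := by
    rw [norm_sub_sq_real, real_inner_smul_right, hd, hy, norm_smul, Real.norm_of_nonneg hμ.le]
    ring
  have h2 : (w y - y) - μ • β = 0 := by
    rw [← norm_eq_zero]
    exact pow_eq_zero_iff (two_ne_zero) |>.mp h1
  rw [sub_sub, sub_eq_zero] at h2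
  exact h2

/-- A hyperbolic element with translation vector along `β` has linear part fixing `β`. -/
lemma fix_of_hyperbolic {w : Equiv.Perm (E m)} {u : E m ≃ₗᵢ[ℝ] E m} {v β : E m}
    (h : IsRep Φ w u v) {c : ℝ} (hc : 0 < c) (hw : IsHyperbolic (w : E m → E m))
    (ht : HasTransVec (w : E m → E m) (c • β)) : u β = β ∧ ⟪v, β⟫ = c * ⟪β, β⟫ := by
  obtain ⟨x, hx⟩ := hw.1
  have hiso : ∀ a b, dist (w a) (w b) = dist a b := by
    intro a b
    rw [h.eq, h.eq, dist_add_right, u.dist_map]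
  have hwx : w x ∈ minSet (w : E m → E m) := by
    rw [minSet, Set.mem_setOf_eq, hiso]
    exact hx
  have e1 := ht x hx
  have e2 := ht (w x) hwx
  have e3 : u β = β := by
    have : c • u β = c • β := by
      rw [← map_smul]
      have a : w (x + c • β) = w x + c • β := by rw [← e1]; exact e2
      rw [h.eq (x + c • β), h.eq x, map_add] at a
      have : u (c • β) = (u x + u (c • β) + v) - (u x + v) := by abel
      rw [this, a]
      abel
    exact smul_right_injective _ hc.ne' this
  refine ⟨e3, ?_⟩
  rw [← h.disp e3 x, e1, add_sub_cancel_left, real_inner_smul_left]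

lemma translation_mem (hΦ : IsRootSystem Φ) {α : E m} (hα : α ∈ Φ) :
    ∃ τ ∈ Waff Φ, ∀ x, τ x = x + coroot α := by
  refine ⟨affRefl α 1 * affRefl α 0, mul_mem (affRefl_mem hα 1) (affRefl_mem hα 0), ?_⟩
  intro x
  rw [Equiv.Perm.mul_apply, affRefl_apply α 1, aff_affRefl, inner_coroot_self (hΦ.ne_zero _ hα),
    affRefl_apply α 0]
  simp only [aff]
  push_cast
  module

lemma Waff_mono {Ψ : Set (E m)} (h : Ψ ⊆ Φ) : Waff Ψ ≤ Waff Φ := by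
  apply Subgroup.closure_mono
  rintro _ ⟨α, hα, k, rfl⟩
  exact ⟨α, h hα, k, rfl⟩

lemma perp_Waff {β : E m} {g : Equiv.Perm (E m)} (hg : g ∈ Waff (perp Φ β)) :
    (∀ y, g (y + β) = g y + β) ∧ ∀ y, ⟪g y, β⟫ = ⟪y, β⟫ := by
  induction hg using Subgroup.closure_induction with
  | mem w hw =>
    obtain ⟨α, hα, k, rfl⟩ := hw
    constructor
    · intro y
      simp only [affRefl_apply, aff, inner_add_right, hα.2]
      rw [add_zero]
      abel
    · intro y
      simp only [affRefl_apply, coroot, inner_sub_left, real_inner_smul_left, hα.2]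
      ring
  | one => exact ⟨fun _ => rfl, fun _ => rfl⟩
  | mul x y _ _ hx hy =>
    refine ⟨fun z => ?_, fun z => ?_⟩
    · rw [Equiv.Perm.mul_apply, hy.1, hx.1]; rfl
    · rw [Equiv.Perm.mul_apply, hx.2, hy.2]
  | inv x _ hx =>
    refine ⟨fun z => ?_, fun z => ?_⟩
    · rw [Equiv.Perm.inv_eq_iff_eq, hx.1]; simp
    · have h3 := hx.2 (x⁻¹ z)
      have e : x (x⁻¹ z) = z := by simp
      rw [e] at h3
      exact h3.symm

/-- existence of a tube stabilizer with the expected translation vector -/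
lemma exists_stab (hΦ : IsRootSystem Φ) (hB : Base Φ Δ ω) (i : Fin m) {x : E m}
    (hxr : Regular (perp Φ (ω i)) x) (hω0 : ω i ≠ 0) :
    ∃ w, IsHypStab Φ (cell (perp Φ (ω i)) x) w ∧
      HasTransVec (w : E m → E m) ((⟪ω i, coroot (Δ i)⟫ / ⟪ω i, ω i⟫) • ω i) := by
  obtain ⟨τ, hτ, hτx⟩ := translation_mem hΦ (hB.mem i)
  have hsub : perp Φ (ω i) ⊆ Φ := fun α hα => hα.1
  have hyr : Regular (perp Φ (ω i)) (τ x) := by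
    rintro _ ⟨α, hα, k, rfl⟩
    obtain ⟨z, hz⟩ := hΦ.crystallographic α hα.1 _ (hB.mem i)
    have e : aff α k (τ x) = aff α (k - z) x := by
      rw [hτx]
      simp only [aff, inner_add_right, hz]
      push_cast
      ring
    rw [e]
    exact hxr _ ⟨α, hα, _, rfl⟩
  obtain ⟨g, hg, hgx⟩ := exists_move (hΦ.finite.subset hsub) (fun α hα => hΦ.ne_zero α hα.1)
    (perp_refl hΦ (ω i)) (fun α hα β hβ => hΦ.crystallographic α hα.1 β hβ.1) hxr _ _ hyr rfl
  have hgW := Waff_mono hsub hg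
  obtain ⟨hg1, hg2⟩ := perp_Waff hg
  set w := g * τ with hw
  have hwW : w ∈ Waff Φ := mul_mem hgW hτ
  obtain ⟨u, v, h⟩ := exists_rep hΦ hwW
  have hu : u (ω i) = ω i := by
    have e : w (0 + ω i) = w 0 + ω i := by
      rw [hw, Equiv.Perm.mul_apply, Equiv.Perm.mul_apply, hτx, hτx, ← hg1]
      congr 1
      abel
    rw [h.eq, h.eq] at e
    simpa [add_comm] using e
  have himg := cell_image hΦ h hu hxr (show w x ∈ cell (perp Φ (ω i)) x from hgx)
  obtain ⟨x0, _, μ, hx0⟩ := fixed_line hΦ hB i h hu hxr himg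
  have hωω : (0:ℝ) < ⟪ω i, ω i⟫ := real_inner_self_pos.mpr hω0
  have hΔΔ : (0:ℝ) < ⟪Δ i, Δ i⟫ := real_inner_self_pos.mpr (hΦ.ne_zero _ (hB.mem i))
  have hμ : μ = ⟪ω i, coroot (Δ i)⟫ / ⟪ω i, ω i⟫ := by
    rw [eq_div_iff hωω.ne']
    have e1 : ⟪w x0, ω i⟫ = ⟪x0, ω i⟫ + ⟪coroot (Δ i), ω i⟫ := by
      rw [hw, Equiv.Perm.mul_apply, hg2, hτx, inner_add_left]
    rw [hx0, inner_add_left, real_inner_smul_left] at e1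
    rw [real_inner_comm (coroot (Δ i)) (ω i)]
    linarith
  have hμpos : 0 < μ := by
    rw [hμ]
    unfold coroot
    rw [real_inner_smul_right, real_inner_comm (Δ i) (ω i), hB.dual, if_pos rfl]
    positivity
  obtain ⟨a, b⟩ := hyperbolic_of h hu hω0 hμpos hx0
  exact ⟨w, ⟨hwW, a, himg⟩, hμ ▸ b⟩

end tube

lemma cox_SAff {Φ : Set (E m)} (hΦ : IsRootSystem Φ) {B ω : Fin m → E m} (hB : Base Φ B ω)
    {αh : E m} (hαh : IsHighestRoot Φ B αh) :
    ∃ C : Set (E m), C.Nonempty ∧ Cox Φ C (SAff B αh) := by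
  have hle : ∀ β ∈ Φ, ∀ l, ⟪β, ω l⟫ ≤ ⟪αh, ω l⟫ := by
    intro β hβ l
    obtain ⟨c, hc, he⟩ := hαh.2 β hβ
    have h1 : ⟪αh - β, ω l⟫ = c l := by rw [he]; exact coeff_eq hB.dual c l
    rw [inner_sub_left] at h1
    have := hc l
    linarith
  have hneg := hB.neg hΦ
  have hS : SAff B αh = Sgen (fun j => -B j) (-αh) := by
    have e : ∀ j, affRefl (-B j) 0 = affRefl (B j) 0 := fun j => by
      simpa using affRefl_neg (B j) 0
    ext w
    simp only [SAff, Sgen, Set.mem_ofPred_eq, e]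
  have hle' : ∀ β ∈ Φ, ∀ l, ⟪β, -ω l⟫ ≤ ⟪-αh, -ω l⟫ := by
    intro β hβ l
    have := hle _ (neg_mem_root hΦ hβ) l
    simp only [inner_neg_left, inner_neg_right] at this ⊢
    linarith
  refine ⟨alc (fun j => -B j) (-αh), hneg.alc_nonempty ?_, ?_⟩
  · intro l
    have h1 := hle _ (neg_mem_root hΦ hαh.1) l
    simp only [inner_neg_left, inner_neg_right] at h1 ⊢
    linarith
  · rw [hS]
    exact hneg.cox hΦ (neg_mem_root hΦ hαh.1) hle'

lemma exists_regular_line {Φ : Set (E m)} (hΦ : IsRootSystem Φ) {β x : E m}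
    (hx : Regular (perp Φ β) x) : ∃ t : ℝ, Regular Φ (x + t • β) := by
  have hcount : (⋃ α ∈ Φ, Set.range fun k : ℤ => ((k : ℝ) - ⟪α, x⟫) / ⟪α, β⟫).Countable :=
    hΦ.finite.countable.biUnion fun α _ => Set.countable_range _
  obtain ⟨t, ht⟩ := (hcount.dense_compl ℝ).nonempty
  refine ⟨t, ?_⟩
  rintro _ ⟨α, hα, k, rfl⟩ h0
  simp only [aff, inner_add_right, real_inner_smul_right] at h0
  by_cases hb : ⟪α, β⟫ = (0:ℝ)
  · refine hx _ ⟨α, ⟨hα, hb⟩, k, rfl⟩ ?_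
    rw [hb] at h0
    simp only [aff]
    linarith
  · apply ht
    simp only [Set.mem_iUnion]
    refine ⟨α, hα, k, ?_⟩
    simp only
    rw [div_eq_iff hb]
    linarith

lemma sepNum_add {Φ : Set (E m)} (hf : Φ.Finite) {x β : E m} {a b : ℝ} (ha : 0 ≤ a)
    (hb : 0 ≤ b) (hy : Regular Φ (x + a • β)) :
    sepNum Φ x (x + (a + b) • β) =
      sepNum Φ x (x + a • β) + sepNum Φ (x + a • β) (x + (a + b) • β) := by
  unfold sepNum
  rw [← Set.ncard_union_eq ?_ (Nset_finite hf _ _) (Nset_finite hf _ _)]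
  · congr 1
    ext f
    constructor
    · rintro ⟨h, h1, h2⟩
      rcases lt_or_gt_of_ne (hy f h) with h3 | h3
      · exact Or.inl ⟨h, h1, h3⟩
      · exact Or.inr ⟨h, h3, h2⟩
    · rintro (⟨⟨α, hα, k, rfl⟩, h1, h2⟩ | ⟨⟨α, hα, k, rfl⟩, h1, h2⟩)
      · refine ⟨⟨α, hα, k, rfl⟩, h1, ?_⟩
        simp only [aff, inner_add_right, real_inner_smul_right] at h1 h2 ⊢
        have : ⟪α, β⟫ ≤ (0:ℝ) := by
          by_contra hc
          push Not at hc
          nlinarith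
        nlinarith
      · refine ⟨⟨α, hα, k, rfl⟩, ?_, h2⟩
        simp only [aff, inner_add_right, real_inner_smul_right] at h1 h2 ⊢
        have : ⟪α, β⟫ ≤ (0:ℝ) := by
          by_contra hc
          push Not at hc
          nlinarith
        nlinarith
  · rw [Set.disjoint_left]
    rintro f ⟨_, _, h1⟩ ⟨_, h2, _⟩
    linarith

lemma sepNum_count {Φ : Set (E m)} (hΦ : IsRootSystem Φ) {B ω : Fin m → E m} (hB : Base Φ B ω)
    {P : Finset (E m)} (hP : IsPositiveSystem Φ B P) (i : Fin m) {x : E m} {s : ℝ} (hs : 0 < s)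
    (hx : Regular Φ x) (hsint : ∀ α ∈ Φ, ∃ z : ℤ, s * ⟪α, ω i⟫ = (z : ℝ)) :
    (sepNum Φ x (x + s • ω i) : ℝ) = s * ⟪∑ α ∈ P, α, ω i⟫ := by
  classical
  have hPm : ∀ α, α ∈ P ↔ α ∈ Φ ∧ ∀ l, 0 ≤ ⟪α, ω l⟫ := by
    intro α
    have : α ∈ P ↔ α ∈ (P : Set (E m)) := Iff.rfl
    rw [this, hP]
    constructor
    · rintro ⟨h1, c, hc, rfl⟩
      exact ⟨h1, fun l => by rw [coeff_eq hB.dual]; exact hc l⟩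
    · rintro ⟨h1, h2⟩
      exact ⟨h1, _, h2, hB.exp α⟩
  have hsint' : ∀ α, ∃ z : ℤ, α ∈ Φ → s * ⟪α, ω i⟫ = (z : ℝ) := by
    intro α
    by_cases h : α ∈ Φ
    · obtain ⟨z, hz⟩ := hsint α h
      exact ⟨z, fun _ => hz⟩
    · exact ⟨0, fun h' => absurd h' h⟩
  choose n hn using hsint'
  let F : Finset (Σ _ : E m, ℤ) :=
    P.sigma fun α => Finset.Ioc ⌊⟪α, x⟫⌋ (⌊⟪α, x⟫⌋ + n α)
  have hset : Nset Φ x (x + s • ω i) =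
      (fun p : (Σ _ : E m, ℤ) => aff (-p.1) (-p.2)) '' (F : Set (Σ _ : E m, ℤ)) := by
    ext b
    constructor
    · rintro ⟨⟨β, hβ, l, rfl⟩, h1, h2⟩
      simp only [aff, inner_add_right, real_inner_smul_right] at h1 h2
      have hneg : ⟪β, ω i⟫ < 0 := by
        by_contra hc
        push Not at hc
        nlinarith
      refine ⟨⟨-β, -l⟩, ?_, by simp⟩
      have hm := neg_mem_root hΦ hβ
      have hnb := hn _ hm
      rw [inner_neg_left] at hnb
      simp only [F, Finset.coe_sigma, Set.mem_sigma_iff, Finset.mem_coe, Finset.mem_Ioc]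
      refine ⟨(hPm _).2 ⟨hm, fun l => ?_⟩, ?_, ?_⟩
      · rcases hB.sign β hβ with h | h
        · exact absurd (h i) (not_le.mpr hneg)
        · rw [inner_neg_left]
          linarith [h l]
      · rw [Int.floor_lt, inner_neg_left]
        push_cast
        linarith
      · rw [← sub_le_iff_le_add, Int.le_floor, inner_neg_left]
        push_cast
        linarith
    · rintro ⟨⟨α, k⟩, hp, rfl⟩
      simp only [F, Finset.coe_sigma, Set.mem_sigma_iff, Finset.mem_coe, Finset.mem_Ioc] at hp
      obtain ⟨hα, h1, h2⟩ := hp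
      have hαΦ := ((hPm _).1 hα).1
      have hm := neg_mem_root hΦ hαΦ
      have hna := hn _ hαΦ
      refine ⟨⟨-α, hm, -k, rfl⟩, ?_, ?_⟩
      · rw [Int.floor_lt] at h1
        simp only [aff, inner_neg_left]
        push_cast
        linarith
      · rw [← sub_le_iff_le_add, Int.le_floor] at h2
        have hne := hx _ ⟨α, hαΦ, k - n α, rfl⟩
        simp only [aff] at hne
        have h3 := lt_of_le_of_ne h2 (fun h => hne (by rw [h]; simp))
        simp only [aff, inner_neg_left, inner_add_right, real_inner_smul_right]
        push_cast at h3 ⊢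
        linarith
  have hinj : Function.Injective (fun p : (Σ _ : E m, ℤ) => aff (-p.1) (-p.2)) := by
    rintro ⟨α, k⟩ ⟨α', k'⟩ h
    have h0 : ∀ y, aff (-α) (-k) y = aff (-α') (-k') y := fun y => congrFun h y
    have hk := h0 0
    simp only [aff, inner_zero_right] at hk
    push_cast at hk
    have hk' : k = k' := by
      have : (k : ℝ) = k' := by linarith
      exact_mod_cast this
    subst hk'
    have hα : α = α' := by
      apply ext_inner_right ℝ
      intro y
      have := h0 y
      simp only [aff, inner_neg_left] at this
      linarith
    subst hα
    rfl
  rw [sepNum, hset, Set.ncard_image_of_injective _ hinj, Set.ncard_coe_finset,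
    Finset.card_sigma, sum_inner, Finset.mul_sum]
  push_cast
  apply Finset.sum_congr rfl
  intro α hα
  have h1 := (hPm α).1 hα
  have hna := hn α h1.1
  have h0 : 0 ≤ n α := by
    have : (0:ℝ) ≤ n α := by rw [← hna]; exact mul_nonneg hs.le (h1.2 i)
    exact_mod_cast this
  rw [Int.card_Ioc, add_sub_cancel_left, hna]
  exact_mod_cast Int.toNat_of_nonneg h0
/-- The hyperbolic generator `w_min` of a geodesic tube of direction
`ω_i∨` is conjugate in `W^aff` to a straight element of length
`((ω_i∨, α_i∨)/(ω_i∨, ω_i∨)) ⟨2ρ, ω_i∨⟩`. -/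
theorem hyperbolic_generator_conjugate_straight {m : ℕ}
    (Φ : Set (E m)) (hΦ : IsRootSystem Φ)
    (B ω : Fin m → E m) (hB : IsSimpleSystem Φ B) (hω : IsFundamentalCoweights B ω)
    (αh : E m) (hαh : IsHighestRoot Φ B αh)
    (P : Finset (E m)) (hP : IsPositiveSystem Φ B P)
    (ρ2 : E m) (hρ2 : ρ2 = ∑ α ∈ P, α)
    (i : Fin m) (T : Set (E m)) (hT : IsGeodesicTube Φ (ω i) T)
    (wmin : Equiv.Perm (E m)) (cmin : ℝ)
    (hwmin : IsHypStab Φ T wmin)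
    (hcmin : HasTransVec (wmin : E m → E m) (cmin • ω i)) (hcpos : 0 < cmin)
    (hminimal : ∀ w : Equiv.Perm (E m), IsHypStab Φ T w →
      ∀ c : ℝ, HasTransVec (w : E m → E m) (c • ω i) → 0 < c → cmin ≤ c) :
    ∃ g ∈ Waff Φ, IsStraight (SAff B αh) (g⁻¹ * wmin * g) ∧
      ((len (SAff B αh) (g⁻¹ * wmin * g) : ℝ) =
        ⟪ω i, coroot (B i)⟫ / ⟪ω i, ω i⟫ * ⟪ρ2, ω i⟫) := by
  have hb : Base Φ B ω := base_of hB hω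
  have hω0 : ω i ≠ 0 := by
    intro h
    have h1 := hω i i
    rw [h] at h1
    simp at h1
  have hωω : 0 < ⟪ω i, ω i⟫ := real_inner_self_pos.mpr hω0
  have hBi : B i ≠ 0 := hΦ.ne_zero _ (hB.mem i)
  have hpair : 0 < ⟪ω i, coroot (B i)⟫ := by
    have h1 : ⟪ω i, B i⟫ = (1 : ℝ) := by rw [real_inner_comm]; simpa using hω i i
    rw [coroot, real_inner_smul_right, h1, mul_one]
    exact div_pos two_pos (real_inner_self_pos.mpr hBi)
  obtain ⟨xT, hxT, rfl⟩ := tube_eq hT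
  obtain ⟨u, v, hrep⟩ := exists_rep hΦ hwmin.1
  obtain ⟨hu, hv⟩ := fix_of_hyperbolic hrep hcpos hwmin.2.1 hcmin
  -- the minimal translation length
  have hc0 : cmin = ⟪ω i, coroot (B i)⟫ / ⟪ω i, ω i⟫ := by
    apply le_antisymm
    · obtain ⟨w, hw, ht⟩ := exists_stab hΦ hb i hxT hω0
      exact hminimal w hw _ ht (div_pos hpair hωω)
    · obtain ⟨z, hz⟩ := hb.lattice hΦ i hrep.lat
      rw [hv, real_inner_comm] at hz
      rw [real_inner_comm] at hz
      rw [real_inner_comm (ω i) (coroot (B i))] at hz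
      have hzpos : (0 : ℝ) < z := by
        by_contra hcon
        push Not at hcon
        nlinarith [mul_pos hcpos hωω]
      have hz1 : (1 : ℝ) ≤ z := by
        have : 0 < z := by exact_mod_cast hzpos
        exact_mod_cast this
      rw [div_le_iff₀ hωω, hz]
      nlinarith
  -- an invariant line through a regular point
  obtain ⟨x0, hx0, μ, hμ⟩ := fixed_line hΦ hb i hrep hu hxT hwmin.2.2
  have hμc : μ = cmin := by
    have h1 := hrep.disp hu x0
    rw [hμ, add_sub_cancel_left, real_inner_smul_left, hv] at h1
    exact mul_right_cancel₀ hωω.ne' h1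
  obtain ⟨t, hreg⟩ := exists_regular_line hΦ (cell_regular hx0)
  set x1 := x0 + t • ω i with hx1
  have hstep : ∀ a : ℝ, wmin (x1 + a • ω i) = x1 + (a + cmin) • ω i := by
    intro a
    have h1 : u x0 + v = x0 + cmin • ω i := by rw [← hrep.eq, hμ, hμc]
    have h2 : u x0 = x0 + cmin • ω i - v := by rw [← h1]; abel
    rw [hrep.eq, hx1, map_add, map_add, map_smul, map_smul, hu, h2]
    module
  have hpow : ∀ k : ℕ, (wmin ^ k) x1 = x1 + ((k : ℝ) * cmin) • ω i := by
    intro k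
    induction k with
    | zero => simp
    | succ k ih =>
      rw [pow_succ', Equiv.Perm.mul_apply, ih, hstep]
      congr 2
      push_cast
      ring
  have hpm : ∀ k : ℕ, wmin ^ k ∈ Waff Φ := fun k => pow_mem hwmin.1 k
  set d := sepNum Φ x1 (wmin x1) with hd
  have hadd : ∀ k : ℕ, sepNum Φ x1 ((wmin ^ k) x1) = k * d := by
    intro k
    induction k with
    | zero =>
      simp only [pow_zero, Equiv.Perm.one_apply, zero_mul, sepNum]
      rw [Set.ncard_eq_zero (Nset_finite hΦ.finite _ _)]
      ext b
      simp only [Nset, Set.mem_ofPred_eq, Set.mem_empty_iff_false, iff_false]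
      rintro ⟨_, h1, h2⟩
      linarith
    | succ k ih =>
      have h1 := hpow k
      have h2 := hpow (k + 1)
      have hr : Regular Φ ((wmin ^ k) x1) := hreg.map hΦ (hpm k)
      have e : ((k + 1 : ℕ) : ℝ) * cmin = (k : ℝ) * cmin + cmin := by push_cast; ring
      rw [e] at h2
      rw [h1] at hr
      have h3 := sepNum_add hΦ.finite (x := x1) (β := ω i) (a := (k : ℝ) * cmin) (b := cmin)
        (by positivity) hcpos.le hr
      rw [← h1, ← h2, ih] at h3
      have h4 : sepNum Φ ((wmin ^ k) x1) ((wmin ^ (k + 1)) x1) = d := by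
        rw [pow_succ, Equiv.Perm.mul_apply, sepNum_map hΦ (hpm k)]
      rw [h3, h4]
      ring
  -- the value of `d`
  have hdval : (d : ℝ) = cmin * ⟪ρ2, ω i⟫ := by
    obtain ⟨N, hN, hNu⟩ := hrep.finOrder hΦ
    obtain ⟨v', hrep'⟩ := hrep.pow N
    have hv' : v' = ((N : ℝ) * cmin) • ω i := by
      have h1 := hpow N
      rw [hrep'.eq, hNu] at h1
      exact add_left_cancel h1
    have hNpos : (0 : ℝ) < N := by exact_mod_cast hN
    have h1 := sepNum_count hΦ hb hP i (x := x1) (s := (N : ℝ) * cmin) (mul_pos hNpos hcpos) hreg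
      (fun α hα => by
        obtain ⟨z, hz⟩ := lattice_int hΦ hα hrep'.lat
        rw [hv', real_inner_smul_right] at hz
        exact ⟨z, hz⟩)
    rw [← hpow N, hadd N, ← hρ2] at h1
    push_cast at h1
    rw [mul_assoc] at h1
    exact mul_left_cancel₀ hNpos.ne' h1
  -- move the regular point into the fundamental alcove
  obtain ⟨C, ⟨p, hp⟩, hC⟩ := cox_SAff hΦ hb hαh
  obtain ⟨h, hh, hpos⟩ := exists_move hΦ.finite hΦ.ne_zero hΦ.reflect_mem hΦ.crystallographic
    (hC.reg p hp) _ x1 hreg rfl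
  have hmem : h x1 ∈ C := Nset_empty_mem hC hp (hreg.map hΦ hh) hpos
  have hconj : ∀ k : ℕ, (h⁻¹⁻¹ * wmin * h⁻¹) ^ k = h * wmin ^ k * h⁻¹ := by
    intro k
    rw [inv_inv, conj_pow]
  have hlen : ∀ k : ℕ, len (SAff B αh) ((h⁻¹⁻¹ * wmin * h⁻¹) ^ k) = k * d := by
    intro k
    rw [hconj, hC.len_eq hΦ hmem (mul_mem (mul_mem hh (hpm k)) (inv_mem hh))]
    have e : (h * wmin ^ k * h⁻¹) (h x1) = h ((wmin ^ k) x1) := by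
      simp [Equiv.Perm.mul_apply]
    rw [e, sepNum_map hΦ hh, hadd]
  have hlen1 : len (SAff B αh) (h⁻¹⁻¹ * wmin * h⁻¹) = d := by
    have := hlen 1
    rwa [pow_one, one_mul] at this
  refine ⟨h⁻¹, inv_mem hh, fun k => ?_, ?_⟩
  · rw [hlen, hlen1]
  · rw [hlen1, hdval, hc0]


end
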